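/- arXiv:1505.00631 — 5 statements merged into one kernel-verified Lean document; each statement's English description precedes it below -/
import Mathlib

section
/- Let 0 < p ≤ ∞ and s > 0 and d ∈ ℕ. Then lim_{n→∞} n^{s/d} · a_n(Id: H^{s,p}(T^d) → L2(T^d)) = (vol(B_p^d))^{s/d}, where B_p^d is the closed unit ball of ℓ_p^d and vol denotes d-dimensional Lebesgue volume. Moreover (vol(B_p^d))^{s/d} is equivalent to d^{-s/p} up to constants depending only on s and p. -/
open MeasureTheory Real Filter
open scoped ENNReal NNReal BigOperators

noncomputable section

/-- The `d`-torus `T^d`, modeled as the cube `[0,2π]^d` with Lebesgue measure. -/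
def torusMeasure (d : ℕ) : Measure (Fin d → ℝ) :=
  volume.restrict (Set.univ.pi fun _ => Set.Icc 0 (2 * π))

/-- `L2(T^d)`. -/
abbrev TorusL2 (d : ℕ) := Lp ℂ 2 (torusMeasure d)

/-- The Fourier coefficient `c_k(f) = (2π)^{-d/2} ∫ f(x) e^{-i k·x} dx`. -/
def fourierCoeffT {d : ℕ} (f : TorusL2 d) (k : Fin d → ℤ) : ℂ :=
  (((2 * π) ^ (-(d : ℝ) / 2) : ℝ) : ℂ) *
    ∫ x, f x * Complex.exp (-Complex.I * ((∑ j, (k j : ℝ) * x j : ℝ) : ℂ)) ∂(torusMeasure d)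

/-- The squared `H^w(T^d)` norm `∑_k w(k)^2 |c_k(f)|^2`, valued in `ℝ≥0∞`. -/
def wNormSq {d : ℕ} (w : (Fin d → ℤ) → ℝ) (f : TorusL2 d) : ℝ≥0∞ :=
  ∑' k : Fin d → ℤ, ENNReal.ofReal (w k ^ 2 * ‖fourierCoeffT f k‖ ^ 2)

/-- The `n`-th approximation number `a_n(Id : H^{w₁}(T^d) → H^{w₂}(T^d))`: the infimum of all
worst-case error bounds `r ≥ 0` achievable by a linear map `A` of rank `< n`, where the error
`‖f - A f‖` is measured in the `H^{w₂}` norm on the unit ball of `H^{w₁}`.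
(With `w₂ ≡ 1` this is the approximation error in `L2(T^d)`, by Parseval.) -/
def approxNumber (d : ℕ) (w₁ w₂ : (Fin d → ℤ) → ℝ) (n : ℕ) : ℝ :=
  sInf { r : ℝ | 0 ≤ r ∧
    ∃ A : TorusL2 d →ₗ[ℂ] TorusL2 d,
      Module.Finite ℂ (LinearMap.range A) ∧
      Module.finrank ℂ (LinearMap.range A) < n ∧
      ∀ f : TorusL2 d, wNormSq w₁ f ≤ 1 →
        wNormSq w₂ (f - A f) ≤ ENNReal.ofReal r ^ 2 }

/-- constant weight `1`, defining `L2(T^d)` as a weighted space. -/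
def constOne (d : ℕ) : (Fin d → ℤ) → ℝ := fun _ => 1

/-- The `ℓ_p` (quasi-)norm on `ℝ^d`, for `0 < p ≤ ∞`. -/
def pNorm (d : ℕ) (p : ℝ≥0∞) (x : Fin d → ℝ) : ℝ :=
  if p = ∞ then ⨆ j, |x j| else (∑ j, |x j| ^ p.toReal) ^ (1 / p.toReal)

/-- The isotropic Sobolev weight `w_{s,p}`. -/
def wIso (d : ℕ) (s : ℝ) (p : ℝ≥0∞) (k : Fin d → ℤ) : ℝ :=
  if p = ∞ then (max 1 (⨆ j, |(k j : ℝ)|)) ^ s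
  else (1 + ∑ j, |(k j : ℝ)| ^ p.toReal) ^ (s / p.toReal)

/-- The Gevrey weight `w^G_{α,β,p}(k) = exp(β ‖k‖_p^α)`. -/
def wGevrey (d : ℕ) (α β : ℝ) (p : ℝ≥0∞) (k : Fin d → ℤ) : ℝ :=
  Real.exp (β * pNorm d p (fun j => (k j : ℝ)) ^ α)

/-- The covering number `N_ε(A)`: the minimal number of closed `ℓ_∞`-balls of radius `ε`
needed to cover `A` (note that on `Fin d → ℝ` the canonical metric is the sup-metric). -/
def coveringNumber {d : ℕ} (ε : ℝ) (A : Set (Fin d → ℝ)) : ℕ∞ :=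
  ⨅ (S : Finset (Fin d → ℝ)) (_ : A ⊆ ⋃ x ∈ S, Metric.closedBall x ε), (S.card : ℕ∞)

/-- The (non-dyadic) entropy number `ε_n(A, ℓ_∞^d)`. -/
def entropyNumber {d : ℕ} (n : ℕ) (A : Set (Fin d → ℝ)) : ℝ :=
  sInf { ε : ℝ | 0 < ε ∧ coveringNumber ε A ≤ (n : ℕ∞) }

/-- The grid number `G(A) = #(A ∩ ℤ^d)`. -/
def gridNumber {d : ℕ} (A : Set (Fin d → ℝ)) : ℕ∞ :=
  (A ∩ {x | ∀ i, ∃ m : ℤ, x i = (m : ℝ)}).encard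

/-- The closed unit ball `B_p^d` of `ℓ_p^d`. -/
def unitBallP (d : ℕ) (p : ℝ≥0∞) : Set (Fin d → ℝ) := {x | pNorm d p x ≤ 1}

end

noncomputable section

open scoped Pointwise

/-! ### Fourier characters on the torus -/

instance isFiniteMeasure_torusMeasure (d : ℕ) : IsFiniteMeasure (torusMeasure d) := by
  refine ⟨?_⟩
  rw [torusMeasure, Measure.restrict_apply_univ]
  exact (isCompact_univ_pi fun _ => isCompact_Icc).measure_lt_top

/-- The normalized character `t ↦ (2π)^{-1/2} e^{imt}`. -/
def character (m : ℤ) (t : ℝ) : ℂ :=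
  (((2 * π) ^ (-(1 : ℝ) / 2) : ℝ) : ℂ) * Complex.exp (Complex.I * ((m * t : ℝ) : ℂ))

lemma continuous_character (m : ℤ) : Continuous (character m) := by
  unfold character; fun_prop

lemma norm_character (m : ℤ) (t : ℝ) : ‖character m t‖ = (2 * π) ^ (-(1 : ℝ) / 2) := by
  rw [character, norm_mul, mul_comm Complex.I, Complex.norm_exp_ofReal_mul_I, mul_one,
    Complex.norm_real, Real.norm_of_nonneg (by positivity)]

lemma conj_character_mul_character (m n : ℤ) (t : ℝ) :
    character n t * (starRingEnd ℂ) (character m t) =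
      (((2 * π)⁻¹ : ℝ) : ℂ) * Complex.exp (Complex.I * (n - m : ℤ) * t) := by
  have h : ((2 * π) ^ (-(1 : ℝ) / 2) : ℝ) * (2 * π) ^ (-(1 : ℝ) / 2) = (2 * π)⁻¹ := by
    rw [← Real.rpow_add (by positivity), ← Real.rpow_neg_one]; norm_num
  rw [character, character, map_mul, Complex.conj_ofReal, ← Complex.exp_conj, map_mul,
    Complex.conj_I, Complex.conj_ofReal, mul_mul_mul_comm, ← Complex.ofReal_mul, h,
    ← Complex.exp_add]
  congr 2
  push_cast
  ring

lemma integral_character_mul_conj (m n : ℤ) :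
    ∫ t in Set.Icc 0 (2 * π), character n t * (starRingEnd ℂ) (character m t) =
      if m = n then 1 else 0 := by
  simp_rw [conj_character_mul_character]
  rw [integral_Icc_eq_integral_Ioc, ← intervalIntegral.integral_of_le (by positivity),
    intervalIntegral.integral_const_mul]
  split_ifs with h
  · subst h
    have : (π : ℂ) ≠ 0 := by exact_mod_cast Real.pi_ne_zero
    simp
    field_simp
  · have hc : Complex.I * (n - m : ℤ) ≠ 0 :=
      mul_ne_zero Complex.I_ne_zero (by exact_mod_cast sub_ne_zero.2 (Ne.symm h))
    rw [integral_exp_mul_complex hc]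
    have : Complex.exp (Complex.I * (n - m : ℤ) * (2 * π : ℝ)) = 1 := by
      rw [← Complex.exp_int_mul_two_pi_mul_I (n - m)]
      congr 1
      push_cast
      ring
    rw [this]
    simp

/-- The multivariate character on the torus. -/
def torusCharacter {d : ℕ} (k : Fin d → ℤ) (x : Fin d → ℝ) : ℂ := ∏ j, character (k j) (x j)

lemma memLp_torusCharacter {d : ℕ} (k : Fin d → ℤ) :
    MemLp (torusCharacter k) 2 (torusMeasure d) := by
  refine MemLp.of_bound (C := ∏ _j : Fin d, (2 * π) ^ (-(1 : ℝ) / 2)) ?_ ?_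
  · refine Continuous.aestronglyMeasurable ?_
    unfold torusCharacter
    exact continuous_finsetProd _ fun j _ => (continuous_character _).comp (continuous_apply j)
  · refine Eventually.of_forall fun x => ?_
    simp only [torusCharacter, norm_prod, norm_character]
    exact le_rfl

/-- The multivariate character as an element of `L2(T^d)`. -/
def torusBasis {d : ℕ} (k : Fin d → ℤ) : TorusL2 d := (memLp_torusCharacter k).toLp _

lemma conj_torusCharacter {d : ℕ} (k : Fin d → ℤ) (x : Fin d → ℝ) :
    (starRingEnd ℂ) (torusCharacter k x) = (((2 * π) ^ (-(d : ℝ) / 2) : ℝ) : ℂ) *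
      Complex.exp (-Complex.I * ((∑ j, (k j : ℝ) * x j : ℝ) : ℂ)) := by
  have h : ((2 * π) ^ (-(d : ℝ) / 2) : ℝ) = ((2 * π) ^ (-(1 : ℝ) / 2)) ^ d := by
    rw [← Real.rpow_natCast, ← Real.rpow_mul (by positivity)]
    congr 1
    ring
  simp only [torusCharacter, character, Finset.prod_mul_distrib, Finset.prod_const,
    Finset.card_univ, Fintype.card_fin, ← Complex.exp_sum, ← Finset.mul_sum, ← Complex.ofReal_sum,
    map_mul, map_pow, Complex.conj_ofReal, ← Complex.exp_conj, Complex.conj_I, h,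
    Complex.ofReal_pow]

lemma fourierCoeffT_eq_inner {d : ℕ} (f : TorusL2 d) (k : Fin d → ℤ) :
    fourierCoeffT f k = inner ℂ (torusBasis k) f := by
  rw [fourierCoeffT, L2.inner_def, ← integral_const_mul]
  refine integral_congr_ae ?_
  filter_upwards [(memLp_torusCharacter k).coeFn_toLp] with x hx
  rw [torusBasis, hx, RCLike.inner_apply, conj_torusCharacter]
  ring

lemma fourierCoeffT_torusBasis {d : ℕ} (k l : Fin d → ℤ) :
    fourierCoeffT (torusBasis l) k = if k = l then 1 else 0 := by
  rw [fourierCoeffT_eq_inner, L2.inner_def]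
  have h : ∫ x, inner ℂ (torusBasis k x) (torusBasis l x) ∂torusMeasure d =
      ∫ x, ∏ j, character (l j) (x j) * (starRingEnd ℂ) (character (k j) (x j))
        ∂torusMeasure d := by
    refine integral_congr_ae ?_
    filter_upwards [(memLp_torusCharacter k).coeFn_toLp,
      (memLp_torusCharacter l).coeFn_toLp] with x hx hy
    rw [torusBasis, hx, torusBasis, hy, RCLike.inner_apply, torusCharacter, torusCharacter,
      map_prod, Finset.prod_mul_distrib]
  rw [h, torusMeasure, volume_pi, Measure.restrict_pi_pi,
    integral_fintype_prod_eq_prod (f := fun j t =>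
      character (l j) t * (starRingEnd ℂ) (character (k j) t))]
  simp_rw [integral_character_mul_conj]
  split_ifs with hkl
  · simp [hkl]
  · obtain ⟨j, hj⟩ := Function.ne_iff.1 hkl
    exact Finset.prod_eq_zero (Finset.mem_univ j) (if_neg hj)

lemma fourierCoeffT_sub {d : ℕ} (f g : TorusL2 d) (k : Fin d → ℤ) :
    fourierCoeffT (f - g) k = fourierCoeffT f k - fourierCoeffT g k := by
  simp only [fourierCoeffT_eq_inner, inner_sub_right]

lemma fourierCoeffT_sum_smul {d : ℕ} (I : Finset (Fin d → ℤ)) (a : (Fin d → ℤ) → ℂ)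
    (k : Fin d → ℤ) :
    fourierCoeffT (∑ l ∈ I, a l • torusBasis l) k = if k ∈ I then a k else 0 := by
  rw [fourierCoeffT_eq_inner, inner_sum]
  simp_rw [inner_smul_right, ← fourierCoeffT_eq_inner, fourierCoeffT_torusBasis]
  simp

/-! ### Two-sided bounds for the approximation numbers -/

lemma approxNumber_le {d n : ℕ} {w : (Fin d → ℤ) → ℝ} {R : ℝ} (hR : 0 < R)
    (I : Finset (Fin d → ℤ)) (hI : I.card < n) (hw : ∀ k ∉ I, R ≤ w k) :
    approxNumber d w (constOne d) n ≤ R⁻¹ := by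
  classical
  refine csInf_le ⟨0, fun r hr => hr.1⟩ ⟨by positivity, ?_⟩
  let A : TorusL2 d →ₗ[ℂ] TorusL2 d :=
    ∑ l ∈ I, ((innerSL ℂ (torusBasis l)).toLinearMap).smulRight (torusBasis l)
  have hA (f) : A f = ∑ l ∈ I, fourierCoeffT f l • torusBasis l := by
    simp [A, fourierCoeffT_eq_inner]
  have hle : LinearMap.range A ≤ Submodule.span ℂ (I.image torusBasis : Finset (TorusL2 d)) := by
    rintro _ ⟨f, rfl⟩
    rw [hA]
    exact Submodule.sum_mem _ fun l hl => Submodule.smul_mem _ _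
      (Submodule.subset_span (Finset.mem_coe.2 (Finset.mem_image_of_mem _ hl)))
  refine ⟨A, Submodule.finiteDimensional_of_le hle, ?_, fun f hf => ?_⟩
  · exact ((Submodule.finrank_mono hle).trans
      ((finrank_span_finset_le_card _).trans Finset.card_image_le)).trans_lt hI
  · calc wNormSq (constOne d) (f - A f) ≤ ENNReal.ofReal R⁻¹ ^ 2 * wNormSq w f := by
          rw [wNormSq, wNormSq, ← ENNReal.tsum_mul_left]
          refine ENNReal.tsum_le_tsum fun k => ?_
          rw [fourierCoeffT_sub, hA, fourierCoeffT_sum_smul, constOne,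
            ← ENNReal.ofReal_pow (by positivity), ← ENNReal.ofReal_mul (by positivity)]
          refine ENNReal.ofReal_le_ofReal ?_
          split_ifs with hk
          · simp; positivity
          · have h1 : 1 ≤ R⁻¹ * w k := by
              rw [inv_mul_eq_div, one_le_div hR]; exact hw k hk
            have h2 : 1 ≤ (R⁻¹ * w k) ^ 2 := one_le_pow₀ h1
            rw [sub_zero, one_pow, ← mul_assoc, ← mul_pow]
            exact mul_le_mul_of_nonneg_right h2 (by positivity)
      _ ≤ _ := by simpa using mul_le_mul_right hf (ENNReal.ofReal R⁻¹ ^ 2)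

lemma le_approxNumber {d n : ℕ} {w : (Fin d → ℤ) → ℝ} {R : ℝ} (hR : 0 < R) (hn : 0 < n)
    (h1 : ∀ k, 1 ≤ w k) (I : Finset (Fin d → ℤ)) (hI : n ≤ I.card) (hw : ∀ k ∈ I, w k ≤ R) :
    R⁻¹ ≤ approxNumber d w (constOne d) n := by
  refine le_csInf ⟨1, zero_le_one, 0, ?_, ?_, fun f hf => ?_⟩ ?_
  · rw [LinearMap.range_zero]; infer_instance
  · rw [LinearMap.range_zero, finrank_bot]; exact hn
  · refine le_trans ?_ (hf.trans (by simp))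
    refine ENNReal.tsum_le_tsum fun k => ENNReal.ofReal_le_ofReal ?_
    have := h1 k
    simp only [LinearMap.zero_apply, sub_zero, constOne]
    gcongr
  · rintro r ⟨hr, A, hfin, hrank, hA⟩
    let Φ : (I → ℂ) →ₗ[ℂ] TorusL2 d := Fintype.linearCombination ℂ fun l : I => torusBasis l.1
    have hker : LinearMap.ker (A.rangeRestrict ∘ₗ Φ) ≠ ⊥ := by
      refine LinearMap.ker_ne_bot_of_finrank_lt ?_
      rw [Module.finrank_pi, Fintype.card_coe]
      omega
    obtain ⟨a, ha, ha0⟩ := (Submodule.ne_bot_iff _).1 hker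
    have hAa : A (Φ a) = 0 := by simpa using congrArg Subtype.val (LinearMap.mem_ker.1 ha)
    have hcoef (k) : fourierCoeffT (Φ a) k = if h : k ∈ I then a ⟨k, h⟩ else 0 := by
      have : Φ a = ∑ l ∈ I, (if h : l ∈ I then a ⟨l, h⟩ else 0) • torusBasis l := by
        rw [← Finset.sum_coe_sort]
        simp [Φ, Fintype.linearCombination_apply]
      rw [this, fourierCoeffT_sum_smul]
      split_ifs <;> rfl
    set S : ℝ := ∑ k ∈ I, ‖fourierCoeffT (Φ a) k‖ ^ 2 with hS
    have hSpos : 0 < S := by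
      obtain ⟨k, hk⟩ := Function.ne_iff.1 ha0
      refine Finset.sum_pos' (fun _ _ => by positivity) ⟨k, k.2, ?_⟩
      rw [hcoef, dif_pos k.2]
      have : a k ≠ 0 := hk
      positivity
    set c : ℝ := (R * √S)⁻¹ with hc
    have hcpos : 0 < c := by positivity
    have hc2 : c ^ 2 * S = R⁻¹ ^ 2 := by
      rw [hc, inv_pow, mul_pow, Real.sq_sqrt hSpos.le]
      field_simp
    have hnorm (v : (Fin d → ℤ) → ℝ) : wNormSq v ((c : ℂ) • Φ a) =
        ENNReal.ofReal (∑ k ∈ I, v k ^ 2 * (c ^ 2 * ‖fourierCoeffT (Φ a) k‖ ^ 2)) := by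
      rw [wNormSq, tsum_eq_sum (s := I), ENNReal.ofReal_sum_of_nonneg fun _ _ => by positivity]
      · refine Finset.sum_congr rfl fun k _ => ?_
        rw [fourierCoeffT_eq_inner, inner_smul_right, ← fourierCoeffT_eq_inner, norm_mul, mul_pow,
          Complex.norm_real, Real.norm_of_nonneg hcpos.le]
      · intro k hk
        rw [fourierCoeffT_eq_inner, inner_smul_right, ← fourierCoeffT_eq_inner, hcoef,
          dif_neg hk]
        simp
    have hle := hA ((c : ℂ) • Φ a) (by
      rw [hnorm, ENNReal.ofReal_le_one]
      calc _ ≤ ∑ k ∈ I, R ^ 2 * (c ^ 2 * ‖fourierCoeffT (Φ a) k‖ ^ 2) := by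
            refine Finset.sum_le_sum fun k hk => ?_
            have := hw k hk
            have := h1 k
            gcongr
        _ = R ^ 2 * (c ^ 2 * S) := by rw [hS, Finset.mul_sum, Finset.mul_sum]
        _ = 1 := by rw [hc2, inv_pow, mul_inv_cancel₀ (by positivity)]
        _ ≤ 1 := le_rfl)
    rw [map_smul, hAa, smul_zero, sub_zero, hnorm, ← ENNReal.ofReal_pow hr,
      ENNReal.ofReal_le_ofReal_iff (by positivity)] at hle
    simp only [constOne, one_pow, one_mul, ← Finset.mul_sum] at hle
    rw [← hS, hc2] at hle
    exact le_of_sq_le_sq hle hr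

/-! ### The `ℓ_p` quasi-norm -/

lemma iSup_abs_eq_norm {d : ℕ} (hd : 0 < d) (x : Fin d → ℝ) : ⨆ j, |x j| = ‖x‖ := by
  have : Nonempty (Fin d) := ⟨⟨0, hd⟩⟩
  refine le_antisymm (ciSup_le fun j => norm_le_pi_norm x j) ?_
  have hb : BddAbove (Set.range fun j => |x j|) := Set.finite_range _ |>.bddAbove
  exact (pi_norm_le_iff_of_nonneg (Real.iSup_nonneg fun _ => abs_nonneg _)).2
    fun j => le_ciSup hb j

lemma pNorm_nonneg (d : ℕ) (p : ℝ≥0∞) (x : Fin d → ℝ) : 0 ≤ pNorm d p x := by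
  unfold pNorm
  split_ifs
  · exact Real.iSup_nonneg fun _ => abs_nonneg _
  · positivity

lemma pNorm_smul (d : ℕ) {p : ℝ≥0∞} (hp : 0 < p) (r : ℝ) (x : Fin d → ℝ) :
    pNorm d p (r • x) = |r| * pNorm d p x := by
  unfold pNorm
  split_ifs with h
  · simp only [Pi.smul_apply, smul_eq_mul, abs_mul]
    rw [Real.mul_iSup_of_nonneg (abs_nonneg r)]
  · have hp' : 0 < p.toReal := ENNReal.toReal_pos hp.ne' h
    simp only [Pi.smul_apply, smul_eq_mul, abs_mul, Real.mul_rpow (abs_nonneg _) (abs_nonneg _)]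
    rw [← Finset.mul_sum, Real.mul_rpow (by positivity) (by positivity), ← Real.rpow_mul
      (abs_nonneg r), mul_one_div_cancel hp'.ne', Real.rpow_one]

lemma continuous_pNorm {d : ℕ} (hd : 0 < d) {p : ℝ≥0∞} (hp : 0 < p) :
    Continuous (pNorm d p) := by
  unfold pNorm
  split_ifs with h
  · simp_rw [iSup_abs_eq_norm hd]
    exact continuous_norm
  · have hp' : 0 < p.toReal := ENNReal.toReal_pos hp.ne' h
    refine Continuous.rpow_const ?_ fun _ => Or.inr (by positivity)
    exact continuous_finsetSum _ fun j _ =>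
      (continuous_apply j).abs.rpow_const fun _ => Or.inr hp'.le

lemma abs_le_pNorm {d : ℕ} {p : ℝ≥0∞} (hp : 0 < p) (x : Fin d → ℝ) (j : Fin d) :
    |x j| ≤ pNorm d p x := by
  unfold pNorm
  split_ifs with h
  · exact le_ciSup (f := fun j => |x j|) (Set.finite_range _ |>.bddAbove) j
  · have hp' : 0 < p.toReal := ENNReal.toReal_pos hp.ne' h
    calc |x j| = (|x j| ^ p.toReal) ^ (1 / p.toReal) := by
          rw [← Real.rpow_mul (abs_nonneg _), mul_one_div_cancel hp'.ne', Real.rpow_one]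
      _ ≤ _ := by
          refine Real.rpow_le_rpow (by positivity) ?_ (by positivity)
          exact Finset.single_le_sum (f := fun j => |x j| ^ p.toReal)
            (fun _ _ => by positivity) (Finset.mem_univ j)

lemma isBounded_unitBallP (d : ℕ) {p : ℝ≥0∞} (hp : 0 < p) :
    Bornology.IsBounded (unitBallP d p) := by
  refine (Metric.isBounded_closedBall (x := (0 : Fin d → ℝ)) (r := 1)).subset fun x hx => ?_
  rw [mem_closedBall_zero_iff]
  exact (pi_norm_le_iff_of_nonneg zero_le_one).2 fun j => (abs_le_pNorm hp x j).trans hx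

lemma isClosed_unitBallP {d : ℕ} (hd : 0 < d) {p : ℝ≥0∞} (hp : 0 < p) :
    IsClosed (unitBallP d p) :=
  isClosed_le (continuous_pNorm hd hp) continuous_const

lemma volume_pNorm_eq_one {d : ℕ} (hd : 0 < d) {p : ℝ≥0∞} (hp : 0 < p) :
    volume {x : Fin d → ℝ | pNorm d p x = 1} = 0 := by
  have hcount := Measure.countable_meas_level_set_pos (μ := (volume : Measure (Fin d → ℝ)))
    (continuous_pNorm hd hp).measurable
  obtain ⟨t, ht0, ht⟩ : ∃ t : ℝ, 0 < t ∧ volume {x : Fin d → ℝ | pNorm d p x = t} = 0 := by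
    by_contra! hcon
    have hsub : Set.Ioi (0 : ℝ) ⊆ {t | 0 < volume {x : Fin d → ℝ | pNorm d p x = t}} :=
      fun t ht => pos_iff_ne_zero.2 (hcon t ht)
    have := (hcount.mono hsub).measure_zero volume
    simp at this
  have hset : {x : Fin d → ℝ | pNorm d p x = 1} = t⁻¹ • {x : Fin d → ℝ | pNorm d p x = t} := by
    ext x
    rw [Set.mem_inv_smul_set_iff₀ ht0.ne', Set.mem_ofPred_eq, Set.mem_ofPred_eq, pNorm_smul d hp,
      abs_of_pos ht0, mul_eq_left₀ ht0.ne']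
  rw [hset, Measure.addHaar_smul, ht, mul_zero]

lemma volume_frontier_unitBallP {d : ℕ} (hd : 0 < d) {p : ℝ≥0∞} (hp : 0 < p) :
    volume (frontier (unitBallP d p)) = 0 :=
  measure_mono_null (frontier_le_subset_eq (continuous_pNorm hd hp) continuous_const)
    (volume_pNorm_eq_one hd hp)

/-! ### Counting lattice points -/

lemma finite_lattice_pNorm_le (d : ℕ) {p : ℝ≥0∞} (hp : 0 < p) (t : ℝ) :
    {k : Fin d → ℤ | pNorm d p (fun j => (k j : ℝ)) ≤ t}.Finite := by
  refine (Set.finite_Icc (fun _ => -⌈t⌉) (fun _ => ⌈t⌉)).subset fun k hk => ?_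
  have h (j : Fin d) : |k j| ≤ ⌈t⌉ := by
    have := ((abs_le_pNorm hp (fun j => (k j : ℝ)) j).trans hk).trans (Int.le_ceil t)
    exact_mod_cast this
  exact ⟨fun j => (abs_le.1 (h j)).1, fun j => (abs_le.1 (h j)).2⟩

/-- The integer points of the `ℓ_p` ball of radius `t`. -/
def latticeBall (d : ℕ) {p : ℝ≥0∞} (hp : 0 < p) (t : ℝ) : Finset (Fin d → ℤ) :=
  (finite_lattice_pNorm_le d hp t).toFinset

lemma mem_latticeBall {d : ℕ} {p : ℝ≥0∞} (hp : 0 < p) {t : ℝ} {k : Fin d → ℤ} :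
    k ∈ latticeBall d hp t ↔ pNorm d p (fun j => (k j : ℝ)) ≤ t := by
  simp [latticeBall]

lemma unitBallP_inter_lattice (d : ℕ) {p : ℝ≥0∞} (hp : 0 < p) {t : ℝ} (ht : 0 < t) :
    unitBallP d p ∩ t⁻¹ • (Submodule.span ℤ (Set.range (Pi.basisFun ℝ (Fin d))) :
      Set (Fin d → ℝ)) =
      (fun (k : Fin d → ℤ) => t⁻¹ • fun j => (k j : ℝ)) '' (latticeBall d hp t) := by
  ext x
  simp only [Set.mem_inter_iff, Set.mem_smul_set, SetLike.mem_coe,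
    Module.Basis.mem_span_iff_repr_mem, Pi.basisFun_repr, Set.mem_image, mem_latticeBall]
  constructor
  · rintro ⟨hx, y, hy, rfl⟩
    choose k hk using hy
    have hky : (fun j => (k j : ℝ)) = y := funext hk
    refine ⟨k, ?_, by rw [hky]⟩
    rw [hky]
    have hx' : pNorm d p (t⁻¹ • y) ≤ 1 := hx
    rwa [pNorm_smul d hp, abs_of_pos (inv_pos.2 ht), inv_mul_le_iff₀ ht, mul_one] at hx'
  · rintro ⟨k, hk, rfl⟩
    refine ⟨?_, _, fun j => ⟨k j, rfl⟩, rfl⟩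
    change pNorm d p _ ≤ 1
    rwa [pNorm_smul d hp, abs_of_pos (inv_pos.2 ht), inv_mul_le_iff₀ ht, mul_one]

lemma tendsto_card_latticeBall {d : ℕ} (hd : 0 < d) {p : ℝ≥0∞} (hp : 0 < p) :
    Tendsto (fun t : ℝ => ((latticeBall d hp t).card : ℝ) / t ^ d) atTop
      (nhds (volume (unitBallP d p)).toReal) := by
  have h := tendsto_card_div_pow_atTop_volume' (unitBallP d p) (isBounded_unitBallP d hp)
    (isClosed_unitBallP hd hp).measurableSet (volume_frontier_unitBallP hd hp) (by
      intro x y hx hxy z hz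
      have hy := hx.trans_le hxy
      rw [Set.mem_smul_set_iff_inv_smul_mem₀ hx.ne'] at hz
      rw [Set.mem_smul_set_iff_inv_smul_mem₀ hy.ne']
      change pNorm d p _ ≤ 1 at hz
      change pNorm d p _ ≤ 1
      rw [pNorm_smul d hp, abs_of_pos (by positivity), inv_mul_le_iff₀ (by positivity),
        mul_one] at hz ⊢
      exact hz.trans hxy)
  refine h.congr' ?_
  filter_upwards [eventually_gt_atTop 0] with t ht
  rw [Fintype.card_fin, unitBallP_inter_lattice d hp ht, Nat.card_image_of_injective]
  · simp
  · intro k l hkl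
    funext j
    have := congrFun hkl j
    simpa [ht.ne'] using this

/-! ### Volume of the `ℓ_p` ball -/

lemma pow_le_volume_unitBallP {d : ℕ} (hd : 0 < d) {p : ℝ≥0∞} (hp : 0 < p) :
    (2 * (d : ℝ) ^ (-(1 / p.toReal))) ^ d ≤ (volume (unitBallP d p)).toReal := by
  have hd' : (0 : ℝ) < d := Nat.cast_pos.2 hd
  have hsub : Metric.closedBall (0 : Fin d → ℝ) ((d : ℝ) ^ (-(1 / p.toReal))) ⊆
      unitBallP d p := by
    intro x hx
    rw [mem_closedBall_zero_iff] at hx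
    change pNorm d p x ≤ 1
    unfold pNorm
    split_ifs with h
    · rw [iSup_abs_eq_norm hd]
      simpa [h] using hx
    · have hp' : 0 < p.toReal := ENNReal.toReal_pos hp.ne' h
      refine Real.rpow_le_one (by positivity) ?_ (by positivity)
      calc ∑ j, |x j| ^ p.toReal ≤ ∑ _j : Fin d, ((d : ℝ) ^ (-(1 / p.toReal))) ^ p.toReal := by
            refine Finset.sum_le_sum fun j _ => ?_
            exact Real.rpow_le_rpow (abs_nonneg _) ((norm_le_pi_norm x j).trans hx) hp'.le
        _ = 1 := by
            rw [← Real.rpow_mul hd'.le, neg_mul, one_div_mul_cancel hp'.ne', Real.rpow_neg_one]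
            simp [hd'.ne']
  have h := ENNReal.toReal_mono (isBounded_unitBallP d hp).measure_lt_top.ne
    (measure_mono hsub : volume _ ≤ volume _)
  rwa [Real.volume_pi_closedBall _ (by positivity), Fintype.card_fin,
    ENNReal.toReal_ofReal (by positivity)] at h

lemma volume_unitBallP_pos {d : ℕ} (hd : 0 < d) {p : ℝ≥0∞} (hp : 0 < p) :
    0 < (volume (unitBallP d p)).toReal := by
  have hd' : (0 : ℝ) < d := Nat.cast_pos.2 hd
  exact (by positivity : (0 : ℝ) < (2 * (d : ℝ) ^ (-(1 / p.toReal))) ^ d).trans_le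
    (pow_le_volume_unitBallP hd hp)

lemma volume_unitBallP_top_le {d : ℕ} (hd : 0 < d) :
    (volume (unitBallP d ∞)).toReal ≤ 2 ^ d := by
  have hsub : unitBallP d ∞ ⊆ Metric.closedBall (0 : Fin d → ℝ) 1 := by
    intro x hx
    rw [mem_closedBall_zero_iff, ← iSup_abs_eq_norm hd]
    have hx' : pNorm d ∞ x ≤ 1 := hx
    rwa [pNorm, if_pos rfl] at hx'
  have h := ENNReal.toReal_mono Metric.isBounded_closedBall.measure_lt_top.ne
    (measure_mono hsub : volume _ ≤ volume _)
  rwa [Real.volume_pi_closedBall _ zero_le_one, Fintype.card_fin, mul_one,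
    ENNReal.toReal_ofReal (by positivity)] at h

lemma volume_unitBallP_le_of_ne_top {d : ℕ} (hd : 0 < d) {p : ℝ≥0∞} (hp : 0 < p) (h : p ≠ ∞) :
    (volume (unitBallP d p)).toReal ≤
      (Real.exp 1 * (2 * Gamma (1 / p.toReal + 1)) * (d : ℝ) ^ (-(1 / p.toReal))) ^ d := by
  have hd' : (0 : ℝ) < d := Nat.cast_pos.2 hd
  have hp' : 0 < p.toReal := ENNReal.toReal_pos hp.ne' h
  have hG : 0 < Gamma (1 / p.toReal + 1) := Real.Gamma_pos_of_pos (by positivity)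
  let f : (Fin d → ℝ) → ℝ := fun x => ∏ j, Real.exp (-d * |x j| ^ p.toReal)
  have hf : ∫ x, f x =
      (2 * ((d : ℝ) ^ (-1 / p.toReal) * Gamma (1 / p.toReal + 1))) ^ d := by
    rw [integral_fintype_prod_volume_eq_pow fun t : ℝ => Real.exp (-d * |t| ^ p.toReal),
      integral_comp_abs (f := fun t => Real.exp (-d * t ^ p.toReal)),
      integral_exp_neg_mul_rpow hp' hd', Fintype.card_fin]
  have hint : Integrable f := by
    refine Integrable.of_integral_ne_zero ?_
    rw [hf]
    positivity
  have hmarkov := mul_meas_ge_le_integral_of_nonneg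
    (Eventually.of_forall fun x => Finset.prod_nonneg fun j _ => (Real.exp_pos _).le) hint
    (Real.exp (-d))
  have hsub : unitBallP d p ⊆ {x | Real.exp (-d) ≤ f x} := by
    intro x hx
    have hx' : pNorm d p x ≤ 1 := hx
    have hsum : ∑ j, |x j| ^ p.toReal ≤ 1 := by
      contrapose! hx'
      rw [pNorm, if_neg h]
      exact Real.one_lt_rpow hx' (by positivity)
    change Real.exp (-d) ≤ ∏ j, Real.exp (-d * |x j| ^ p.toReal)
    rw [← Real.exp_sum, ← Finset.mul_sum, Real.exp_le_exp]
    nlinarith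
  have hfin : volume {x | Real.exp (-d) ≤ f x} ≠ ∞ := (hint.measure_ge_lt_top (Real.exp_pos _)).ne
  have hvol : (volume (unitBallP d p)).toReal ≤ volume.real {x | Real.exp (-d) ≤ f x} :=
    ENNReal.toReal_mono hfin (measure_mono hsub)
  calc (volume (unitBallP d p)).toReal
      = Real.exp d * (Real.exp (-d) * (volume (unitBallP d p)).toReal) := by
        rw [← mul_assoc, ← Real.exp_add]; simp
    _ ≤ Real.exp d * ∫ x, f x := by
        gcongr
        exact le_trans (by gcongr) hmarkov
    _ = _ := by
        rw [hf, ← Real.exp_one_pow, ← mul_pow, neg_div]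
        ring

lemma exists_volume_unitBallP_le {p : ℝ≥0∞} (hp : 0 < p) : ∃ C : ℝ, 0 < C ∧ ∀ d : ℕ, 0 < d →
    (volume (unitBallP d p)).toReal ≤ (C * (d : ℝ) ^ (-(1 / p.toReal))) ^ d := by
  by_cases h : p = ∞
  · subst h
    exact ⟨2, two_pos, fun d hd => by simpa using volume_unitBallP_top_le hd⟩
  · have hp' : 0 < p.toReal := ENNReal.toReal_pos hp.ne' h
    have hG : 0 < Gamma (1 / p.toReal + 1) := Real.Gamma_pos_of_pos (by positivity)
    exact ⟨_, by positivity, fun d hd => volume_unitBallP_le_of_ne_top hd hp h⟩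

lemma mul_rpow_pow_rpow {d : ℕ} (hd : 0 < d) {C : ℝ} (hC : 0 < C) (q s : ℝ) :
    ((C * (d : ℝ) ^ (-(1 / q))) ^ d) ^ (s / d) = C ^ s * (d : ℝ) ^ (-(s / q)) := by
  have hd' : (0 : ℝ) < d := Nat.cast_pos.2 hd
  rw [← Real.rpow_natCast, ← Real.rpow_mul (by positivity), mul_div_cancel₀ _ hd'.ne',
    Real.mul_rpow hC.le (by positivity), ← Real.rpow_mul hd'.le]
  congr 2
  ring

/-! ### Asymptotics of the approximation numbers -/

/-- The profile `g` with `w_{s,p}(k) = g(‖k‖_p)^s`. -/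
def radialProfile (p : ℝ≥0∞) (t : ℝ) : ℝ :=
  if p = ∞ then max 1 t else (1 + t ^ p.toReal) ^ (1 / p.toReal)

lemma wIso_eq_radialProfile {d : ℕ} {s : ℝ} {p : ℝ≥0∞} (hp : 0 < p) (k : Fin d → ℤ) :
    wIso d s p k = radialProfile p (pNorm d p fun j => (k j : ℝ)) ^ s := by
  unfold wIso radialProfile pNorm
  split_ifs with h
  · rfl
  · have hp' : 0 < p.toReal := ENNReal.toReal_pos hp.ne' h
    rw [← Real.rpow_mul (by positivity), one_div_mul_eq_div, ← Real.rpow_mul (by positivity),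
      one_div_mul_cancel hp'.ne', Real.rpow_one]

lemma one_le_radialProfile (p : ℝ≥0∞) {t : ℝ} (ht : 0 ≤ t) : 1 ≤ radialProfile p t := by
  unfold radialProfile
  split_ifs
  · exact le_max_left _ _
  · exact Real.one_le_rpow (le_add_of_nonneg_right (by positivity)) (by positivity)

lemma le_radialProfile {p : ℝ≥0∞} (hp : 0 < p) {t : ℝ} (ht : 0 ≤ t) : t ≤ radialProfile p t := by
  unfold radialProfile
  split_ifs with h
  · exact le_max_right _ _
  · have hp' : 0 < p.toReal := ENNReal.toReal_pos hp.ne' h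
    calc t = (t ^ p.toReal) ^ (1 / p.toReal) := by
          rw [← Real.rpow_mul ht, mul_one_div_cancel hp'.ne', Real.rpow_one]
      _ ≤ _ := Real.rpow_le_rpow (by positivity) (by linarith) (by positivity)

lemma radialProfile_mono (p : ℝ≥0∞) {t u : ℝ} (ht : 0 ≤ t) (htu : t ≤ u) :
    radialProfile p t ≤ radialProfile p u := by
  unfold radialProfile
  split_ifs with h
  · exact max_le_max le_rfl htu
  · gcongr

lemma tendsto_div_radialProfile {p : ℝ≥0∞} (hp : 0 < p) :
    Tendsto (fun t => t / radialProfile p t) atTop (nhds 1) := by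
  by_cases h : p = ∞
  · refine tendsto_const_nhds.congr' ?_
    filter_upwards [eventually_ge_atTop 1] with t ht
    rw [radialProfile, if_pos h, max_eq_right ht, div_self (by positivity)]
  · have hp' : 0 < p.toReal := ENNReal.toReal_pos hp.ne' h
    have h1 : Tendsto (fun t : ℝ => (t ^ (-p.toReal) + 1) ^ (-(1 / p.toReal))) atTop
        (nhds ((0 + 1) ^ (-(1 / p.toReal)))) :=
      ((tendsto_rpow_neg_atTop hp').add_const 1).rpow_const (Or.inl (by norm_num))
    rw [zero_add, Real.one_rpow] at h1
    refine h1.congr' ?_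
    filter_upwards [eventually_gt_atTop 0] with t ht
    have h2 : t ^ (-p.toReal) + 1 = (1 + t ^ p.toReal) / t ^ p.toReal := by
      rw [Real.rpow_neg ht.le]
      field_simp
    rw [radialProfile, if_neg h, h2, Real.rpow_neg (by positivity),
      Real.div_rpow (by positivity) (by positivity), ← Real.rpow_mul ht.le,
      mul_one_div_cancel hp'.ne', Real.rpow_one, inv_div]

/-- The radius `t` with `t ^ d = n / u`. -/
def countRadius (d : ℕ) (u : ℝ) (n : ℕ) : ℝ := ((n : ℝ) / u) ^ (1 / (d : ℝ))

lemma countRadius_rpow (d : ℕ) {u : ℝ} (hu : 0 < u) (s : ℝ) (n : ℕ) :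
    countRadius d u n ^ s = (n : ℝ) ^ (s / d) / u ^ (s / d) := by
  rw [countRadius, ← Real.rpow_mul (by positivity), one_div_mul_eq_div,
    Real.div_rpow (by positivity) hu.le]

lemma tendsto_countRadius {d : ℕ} (hd : 0 < d) {u : ℝ} (hu : 0 < u) :
    Tendsto (countRadius d u) atTop atTop := by
  have hd' : (0 : ℝ) < d := Nat.cast_pos.2 hd
  exact (tendsto_rpow_atTop (by positivity : 0 < 1 / (d : ℝ))).comp
    (tendsto_natCast_atTop_atTop.atTop_div_const hu)

lemma tendsto_card_latticeBall_countRadius {d : ℕ} (hd : 0 < d) {p : ℝ≥0∞} (hp : 0 < p)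
    {u : ℝ} (hu : 0 < u) :
    Tendsto (fun n : ℕ => ((latticeBall d hp (countRadius d u n)).card : ℝ) / n) atTop
      (nhds ((volume (unitBallP d p)).toReal / u)) := by
  have hd' : (d : ℝ) ≠ 0 := Nat.cast_ne_zero.2 hd.ne'
  refine (((tendsto_card_latticeBall hd hp).comp (tendsto_countRadius hd hu)).div_const u).congr ?_
  intro n
  have : countRadius d u n ^ d = n / u := by
    rw [← Real.rpow_natCast, countRadius_rpow d hu, div_self hd', Real.rpow_one, Real.rpow_one]
  rw [Function.comp_apply, this]
  field_simp

lemma eventually_mul_approxNumber_le {d : ℕ} (hd : 0 < d) {p : ℝ≥0∞} (hp : 0 < p) {s : ℝ}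
    (hs : 0 < s) {u : ℝ} (hu : (volume (unitBallP d p)).toReal < u) :
    ∀ᶠ n : ℕ in atTop,
      (n : ℝ) ^ (s / (d : ℝ)) * approxNumber d (wIso d s p) (constOne d) n ≤ u ^ (s / (d : ℝ)) := by
  have hu0 : 0 < u := ENNReal.toReal_nonneg.trans_lt hu
  filter_upwards [(tendsto_card_latticeBall_countRadius hd hp hu0).eventually_lt_const
    ((div_lt_one hu0).2 hu), eventually_gt_atTop 0] with n hn hn0
  have hn0' : (0 : ℝ) < n := Nat.cast_pos.2 hn0
  have ht : 0 < countRadius d u n := by unfold countRadius; positivity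
  have hcard : (latticeBall d hp (countRadius d u n)).card < n := by
    rw [div_lt_one hn0'] at hn
    exact_mod_cast hn
  have h := approxNumber_le (w := wIso d s p) (R := countRadius d u n ^ s) (by positivity) _ hcard
    (by
      intro k hk
      rw [mem_latticeBall, not_le] at hk
      rw [wIso_eq_radialProfile hp]
      exact Real.rpow_le_rpow ht.le (hk.le.trans (le_radialProfile hp (pNorm_nonneg _ _ _))) hs.le)
  calc _ ≤ (n : ℝ) ^ (s / (d : ℝ)) * (countRadius d u n ^ s)⁻¹ := by gcongr
    _ = u ^ (s / (d : ℝ)) := by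
      rw [countRadius_rpow d hu0]
      field_simp

lemma eventually_lt_mul_approxNumber {d : ℕ} (hd : 0 < d) {p : ℝ≥0∞} (hp : 0 < p) {s : ℝ}
    (hs : 0 < s) {u : ℝ} (hu0 : 0 < u) (hu : u < (volume (unitBallP d p)).toReal) {b : ℝ}
    (hb : b < u ^ (s / (d : ℝ))) :
    ∀ᶠ n : ℕ in atTop,
      b < (n : ℝ) ^ (s / (d : ℝ)) * approxNumber d (wIso d s p) (constOne d) n := by
  have hlim : Tendsto (fun n => (countRadius d u n / radialProfile p (countRadius d u n)) ^ s *
      u ^ (s / (d : ℝ))) atTop (nhds (u ^ (s / (d : ℝ)))) := by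
    have := (((tendsto_div_radialProfile hp).comp (tendsto_countRadius hd hu0)).rpow_const
      (p := s) (Or.inl one_ne_zero)).mul_const (u ^ (s / (d : ℝ)))
    simpa using this
  filter_upwards [(tendsto_card_latticeBall_countRadius hd hp hu0).eventually_const_lt
    ((one_lt_div hu0).2 hu), eventually_gt_atTop 0, hlim.eventually_const_lt hb] with n hn hn0 hbn
  have hn0' : (0 : ℝ) < n := Nat.cast_pos.2 hn0
  have ht : 0 < countRadius d u n := by unfold countRadius; positivity
  have hg : 0 < radialProfile p (countRadius d u n) :=
    zero_lt_one.trans_le (one_le_radialProfile p ht.le)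
  have hcard : n ≤ (latticeBall d hp (countRadius d u n)).card := by
    rw [one_lt_div hn0'] at hn
    exact_mod_cast hn.le
  have h := le_approxNumber (w := wIso d s p)
    (R := radialProfile p (countRadius d u n) ^ s) (by positivity) hn0
    (fun k => by
      rw [wIso_eq_radialProfile hp]
      exact Real.one_le_rpow (one_le_radialProfile p (pNorm_nonneg _ _ _)) hs.le) _ hcard
    (by
      intro k hk
      rw [mem_latticeBall] at hk
      rw [wIso_eq_radialProfile hp]
      exact Real.rpow_le_rpow (zero_le_one.trans (one_le_radialProfile p (pNorm_nonneg _ _ _)))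
        (radialProfile_mono p (pNorm_nonneg _ _ _) hk) hs.le)
  calc b < _ := hbn
    _ = (n : ℝ) ^ (s / (d : ℝ)) * (radialProfile p (countRadius d u n) ^ s)⁻¹ := by
      rw [Real.div_rpow ht.le hg.le, countRadius_rpow d hu0]
      field_simp
    _ ≤ _ := by gcongr

lemma tendsto_mul_approxNumber {d : ℕ} (hd : 0 < d) {p : ℝ≥0∞} (hp : 0 < p) {s : ℝ}
    (hs : 0 < s) :
    Tendsto (fun n : ℕ => (n : ℝ) ^ (s / (d : ℝ)) * approxNumber d (wIso d s p) (constOne d) n)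
      atTop (nhds ((volume (unitBallP d p)).toReal ^ (s / (d : ℝ)))) := by
  set V := (volume (unitBallP d p)).toReal
  have hVpos : 0 < V := volume_unitBallP_pos hd hp
  have hcont : Tendsto (fun u : ℝ => u ^ (s / (d : ℝ))) (nhds V) (nhds (V ^ (s / (d : ℝ)))) :=
    Real.continuousAt_rpow_const _ _ (Or.inl hVpos.ne')
  refine tendsto_order.2 ⟨fun b hb => ?_, fun b hb => ?_⟩
  · obtain ⟨u, ⟨hbu, hu0⟩, huV⟩ := ((((hcont.eventually_const_lt hb).and
      (eventually_gt_nhds hVpos)).filter_mono nhdsWithin_le_nhds).and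
        (self_mem_nhdsWithin (s := Set.Iio V))).exists
    exact eventually_lt_mul_approxNumber hd hp hs hu0 huV hbu
  · obtain ⟨u, hbu, huV⟩ := (((hcont.eventually_lt_const hb).filter_mono nhdsWithin_le_nhds).and
        (self_mem_nhdsWithin (s := Set.Ioi V))).exists
    filter_upwards [eventually_mul_approxNumber_le hd hp hs huV] with n hn
    exact hn.trans_lt hbu

/-- the limit `lim_n n^{s/d} a_n(Id : H^{s,p}(T^d) → L2(T^d)) = vol(B_p^d)^{s/d}`,
and `vol(B_p^d)^{s/d} ≍ d^{-s/p}` with constants depending only on `s` and `p`. -/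
theorem statement1 (p : ℝ≥0∞) (hp : 0 < p) (s : ℝ) (hs : 0 < s) (d : ℕ) (hd : 0 < d) :
    Filter.Tendsto
      (fun n : ℕ => (n : ℝ) ^ (s / (d : ℝ)) * approxNumber d (wIso d s p) (constOne d) n)
      Filter.atTop (nhds ((volume (unitBallP d p)).toReal ^ (s / (d : ℝ)))) ∧
    ∃ c C : ℝ, 0 < c ∧ 0 < C ∧ ∀ d' : ℕ, 0 < d' →
      c * (d' : ℝ) ^ (-(s / p.toReal)) ≤ (volume (unitBallP d' p)).toReal ^ (s / (d' : ℝ)) ∧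
      (volume (unitBallP d' p)).toReal ^ (s / (d' : ℝ)) ≤ C * (d' : ℝ) ^ (-(s / p.toReal)) := by
  refine ⟨tendsto_mul_approxNumber hd hp hs, ?_⟩
  obtain ⟨C, hC, hvol⟩ := exists_volume_unitBallP_le hp
  refine ⟨2 ^ s, C ^ s, by positivity, by positivity, fun d' hd' => ?_⟩
  have hexp : 0 ≤ s / (d' : ℝ) := by positivity
  rw [← mul_rpow_pow_rpow hd' two_pos, ← mul_rpow_pow_rpow hd' hC]
  exact ⟨Real.rpow_le_rpow (by positivity) (pow_le_volume_unitBallP hd' hp) hexp,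
    Real.rpow_le_rpow ENNReal.toReal_nonneg (hvol d' hd') hexp⟩

end
end

section
/- Let A ⊆ R^d be a solid set, i.e., whenever x ∈ A and y ∈ R^d satisfies |y_i| ≤ |x_i| for all i = 1,…,d, then y ∈ A. Then for every ρ with 0 < ρ < 1/2 one has N_1(A) ≤ G(A) ≤ N_ρ(A), where G(A) = #(A ∩ Z^d) is the grid number of A. -/
open MeasureTheory Real Filter
open scoped ENNReal NNReal BigOperators

noncomputable section

/-- Every point of a solid set lies within sup-distance `1` of an integer point of the set. -/
theorem exists_grid_point_dist_le_one {d : ℕ} {A : Set (Fin d → ℝ)}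
    (hsolid : ∀ x ∈ A, ∀ y : Fin d → ℝ, (∀ i, |y i| ≤ |x i|) → y ∈ A)
    {x : Fin d → ℝ} (hx : x ∈ A) :
    ∃ y ∈ A ∩ {x | ∀ i, ∃ m : ℤ, x i = (m : ℝ)}, dist x y ≤ 1 := by
  have key : ∀ t : ℝ, ∃ m : ℤ, |(m : ℝ)| ≤ |t| ∧ |t - m| ≤ 1 := by
    intro t
    rcases le_total 0 t with ht | ht
    · have h0 : (0 : ℝ) ≤ ⌊t⌋ := by exact_mod_cast Int.floor_nonneg.2 ht
      have h1 := Int.floor_le t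
      have h2 := Int.lt_floor_add_one t
      refine ⟨⌊t⌋, ?_, ?_⟩
      · rwa [abs_of_nonneg h0, abs_of_nonneg ht]
      · rw [abs_le]; constructor <;> linarith
    · have h0 : (⌈t⌉ : ℝ) ≤ 0 := by exact_mod_cast Int.ceil_le.2 (by simpa using ht)
      have h1 := Int.le_ceil t
      have h2 := Int.ceil_lt_add_one t
      refine ⟨⌈t⌉, ?_, ?_⟩
      · rw [abs_of_nonpos h0, abs_of_nonpos ht]; linarith
      · rw [abs_le]; constructor <;> linarith
  choose m hm hd using key
  refine ⟨fun i => m (x i), ⟨hsolid x hx _ fun i => hm (x i), fun i => ⟨m (x i), rfl⟩⟩, ?_⟩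
  exact (dist_pi_le_iff zero_le_one).2 fun i => by simpa [Real.dist_eq] using hd (x i)

/-- Integer points in a common closed sup-ball of radius `ρ < 1 / 2` coincide. -/
theorem eq_of_grid_of_mem_closedBall {d : ℕ} {ρ : ℝ} (hρ : ρ < 1 / 2) {x y c : Fin d → ℝ}
    (hx : ∀ i, ∃ m : ℤ, x i = (m : ℝ)) (hy : ∀ i, ∃ m : ℤ, y i = (m : ℝ))
    (hxc : x ∈ Metric.closedBall c ρ) (hyc : y ∈ Metric.closedBall c ρ) : x = y := by
  funext i
  obtain ⟨m, hm⟩ := hx i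
  obtain ⟨n, hn⟩ := hy i
  have h : dist (x i) (y i) < 1 := by
    have := dist_triangle_right x y c
    have := dist_le_pi_dist x y i
    rw [Metric.mem_closedBall] at hxc hyc
    linarith
  rw [hm, hn, Real.dist_eq] at h
  have hmn : |m - n| < 1 := by exact_mod_cast h
  rw [hm, hn, sub_eq_zero.1 (Int.abs_lt_one_iff.1 hmn)]

/-- for a solid set `A ⊆ ℝ^d` and `0 < ρ < 1/2`, `N_1(A) ≤ G(A) ≤ N_ρ(A)`. -/
theorem statement4 (d : ℕ) (hd : 0 < d) (A : Set (Fin d → ℝ))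
    (hsolid : ∀ x ∈ A, ∀ y : Fin d → ℝ, (∀ i, |y i| ≤ |x i|) → y ∈ A)
    (ρ : ℝ) (hρ0 : 0 < ρ) (hρ : ρ < 1 / 2) :
    coveringNumber 1 A ≤ gridNumber A ∧ gridNumber A ≤ coveringNumber ρ A := by
  constructor
  · rcases Set.finite_or_infinite (A ∩ {x | ∀ i, ∃ m : ℤ, x i = (m : ℝ)}) with hfin | hinf
    · rw [gridNumber, hfin.encard_eq_coe_toFinset_card]
      refine iInf₂_le hfin.toFinset fun x hx => ?_
      obtain ⟨y, hy, hxy⟩ := exists_grid_point_dist_le_one hsolid hx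
      exact Set.mem_iUnion₂.2 ⟨y, hfin.mem_toFinset.2 hy, hxy⟩
    · rw [gridNumber, hinf.encard_eq]
      exact le_top
  · refine le_iInf₂ fun S hS => ?_
    have hcov : ∀ x : Fin d → ℝ, ∃ c, x ∈ A → c ∈ S ∧ x ∈ Metric.closedBall c ρ := by
      intro x
      by_cases hx : x ∈ A
      · obtain ⟨c, hc, hxc⟩ := Set.mem_iUnion₂.1 (hS hx)
        exact ⟨c, fun _ => ⟨hc, hxc⟩⟩
      · exact ⟨x, fun h => absurd h hx⟩
    choose c hc using hcov
    rw [gridNumber, ← Set.encard_coe_eq_coe_finsetCard]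
    refine Set.encard_le_encard_of_injOn (f := c) (fun x hx => (hc x hx.1).1) ?_
    intro x hx y hy hxy
    exact eq_of_grid_of_mem_closedBall hρ hx.2 hy.2 (hc x hx.1).2 (hxy ▸ (hc y hy.1).2)

end
end

section
/- Let 0 < p ≤ 1 and let ‖·‖ be a p-norm on R^d with closed unit ball B_{‖·‖}^d. Then lim_{n→∞} n^{1/d} · ε_n(id: ℓ_{‖·‖}^d → ℓ_∞^d) = (1/2)·(vol(B_{‖·‖}^d))^{1/d}. -/
open MeasureTheory Real Filter
open scoped ENNReal NNReal BigOperators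

noncomputable section

section EntropyAsymptotics

variable {d : ℕ}

theorem exists_finset_of_coveringNumber_le {ε : ℝ} {A : Set (Fin d → ℝ)} {n : ℕ}
    (h : coveringNumber ε A ≤ (n : ℕ∞)) :
    ∃ S : Finset (Fin d → ℝ), A ⊆ ⋃ x ∈ S, Metric.closedBall x ε ∧ S.card ≤ n := by
  have h1 : coveringNumber ε A < ((n + 1 : ℕ) : ℕ∞) :=
    lt_of_le_of_lt h (by exact_mod_cast Nat.lt_succ_self n)
  simp only [coveringNumber, iInf_lt_iff] at h1
  obtain ⟨S, hS, hc⟩ := h1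
  exact ⟨S, hS, Nat.lt_succ_iff.mp (by exact_mod_cast hc)⟩

theorem coveringNumber_le_card {ε : ℝ} {A : Set (Fin d → ℝ)} (S : Finset (Fin d → ℝ))
    (h : A ⊆ ⋃ x ∈ S, Metric.closedBall x ε) : coveringNumber ε A ≤ (S.card : ℕ∞) :=
  iInf₂_le S h

theorem volume_le_of_coveringNumber_le {ε : ℝ} (hε : 0 ≤ ε) {A : Set (Fin d → ℝ)} {n : ℕ}
    (h : coveringNumber ε A ≤ (n : ℕ∞)) :
    volume A ≤ ENNReal.ofReal (n * (2 * ε) ^ d) := by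
  obtain ⟨S, hS, hc⟩ := exists_finset_of_coveringNumber_le h
  calc volume A ≤ ∑ x ∈ S, volume (Metric.closedBall x ε) :=
        (measure_mono hS).trans (measure_biUnion_finset_le _ _)
    _ = S.card * ENNReal.ofReal ((2 * ε) ^ d) := by
        simp [Real.volume_pi_closedBall _ hε]
    _ ≤ n * ENNReal.ofReal ((2 * ε) ^ d) := by gcongr
    _ = ENNReal.ofReal (n * (2 * ε) ^ d) := by
        rw [ENNReal.ofReal_mul (by positivity), ENNReal.ofReal_natCast]

/-- The half-open cube of side `s` and lower corner `s • k`. -/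
def gridCell (s : ℝ) (k : Fin d → ℤ) : Set (Fin d → ℝ) :=
  Set.univ.pi fun i => Set.Ico (s * k i) (s * k i + s)

theorem mem_gridCell_iff {s : ℝ} (hs : 0 < s) {k : Fin d → ℤ} {x : Fin d → ℝ} :
    x ∈ gridCell s k ↔ (fun i => ⌊x i / s⌋) = k := by
  simp only [gridCell, Set.mem_univ_pi, Set.mem_Ico, funext_iff, Int.floor_eq_iff]
  refine forall_congr' fun i => ?_
  rw [le_div_iff₀ hs, div_lt_iff₀ hs, add_mul, one_mul, mul_comm s]

theorem volume_gridCell {s : ℝ} (hs : 0 ≤ s) (k : Fin d → ℤ) :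
    volume (gridCell s k) = ENNReal.ofReal (s ^ d) := by
  rw [gridCell, Real.volume_pi_Ico]
  simp [ENNReal.ofReal_pow hs]

theorem dist_le_of_mem_gridCell {s : ℝ} (hs : 0 ≤ s) {k : Fin d → ℤ} {x y : Fin d → ℝ}
    (hx : x ∈ gridCell s k) (hy : y ∈ gridCell s k) : dist x y ≤ s := by
  refine (dist_pi_le_iff hs).2 fun i => ?_
  have h1 := hx i trivial
  have h2 := hy i trivial
  rw [Real.dist_eq, abs_le]
  constructor <;> linarith [h1.1, h1.2, h2.1, h2.2]

theorem card_mul_le_volume_cthickening {s : ℝ} (hs : 0 < s) {A : Set (Fin d → ℝ)}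
    (T : Finset (Fin d → ℤ)) (hT : ∀ k ∈ T, (A ∩ gridCell s k).Nonempty) :
    ENNReal.ofReal (T.card * s ^ d) ≤ volume (Metric.cthickening s A) := by
  have hdisj : Set.PairwiseDisjoint (T : Set (Fin d → ℤ)) (gridCell s) := by
    intro k _ l _ hkl
    refine Set.disjoint_left.2 fun x hk hl => hkl ?_
    rw [mem_gridCell_iff hs] at hk hl
    exact hk.symm.trans hl
  have hmeas : ∀ k ∈ T, MeasurableSet (gridCell s k) := fun k _ =>
    MeasurableSet.univ_pi fun _ => measurableSet_Ico
  calc ENNReal.ofReal (T.card * s ^ d) = volume (⋃ k ∈ T, gridCell s k) := by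
        rw [measure_biUnion_finset hdisj hmeas, ENNReal.ofReal_mul (by positivity),
          ENNReal.ofReal_natCast]
        simp [volume_gridCell hs.le]
    _ ≤ volume (Metric.cthickening s A) := by
        refine measure_mono (Set.iUnion₂_subset fun k hk y hy => ?_)
        obtain ⟨x, hxA, hx⟩ := hT k hk
        exact Metric.mem_cthickening_of_dist_le y x s A hxA (dist_le_of_mem_gridCell hs.le hy hx)

theorem coveringNumber_le_of_volume_cthickening_lt {ε : ℝ} (hε : 0 < ε) {A : Set (Fin d → ℝ)}
    {n : ℕ} (h : volume (Metric.cthickening (2 * ε) A) < ENNReal.ofReal ((n + 1) * (2 * ε) ^ d)) :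
    coveringNumber ε A ≤ (n : ℕ∞) := by
  have hs : 0 < 2 * ε := by positivity
  set K : Set (Fin d → ℤ) := {k | (A ∩ gridCell (2 * ε) k).Nonempty}
  have hK : K.encard ≤ (n : ℕ∞) := by
    by_contra! hlt
    have hle : ((n + 1 : ℕ) : ℕ∞) ≤ K.encard := by
      simpa using Order.add_one_le_of_lt hlt
    obtain ⟨T, hTK, hT⟩ := Set.exists_subset_encard_eq hle
    have hfin : T.Finite := Set.finite_of_encard_eq_coe hT
    have hcard : hfin.toFinset.card = n + 1 := by
      rw [hfin.encard_eq_coe_toFinset_card] at hT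
      exact_mod_cast hT
    have := card_mul_le_volume_cthickening hs (A := A) hfin.toFinset
      fun k hk => hTK (hfin.mem_toFinset.1 hk)
    rw [hcard] at this
    push_cast at this
    exact absurd h (not_lt.2 this)
  have hfin : K.Finite := Set.finite_of_encard_le_coe hK
  classical
  let S : Finset (Fin d → ℝ) := hfin.toFinset.image fun k i => 2 * ε * k i + ε
  have hcov : A ⊆ ⋃ x ∈ S, Metric.closedBall x ε := by
    intro x hx
    have hcell : x ∈ gridCell (2 * ε) (fun i => ⌊x i / (2 * ε)⌋) := (mem_gridCell_iff hs).2 rfl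
    refine Set.mem_iUnion₂.2 ⟨_, Finset.mem_image_of_mem _
      (hfin.mem_toFinset.2 ⟨x, hx, hcell⟩), ?_⟩
    refine Metric.mem_closedBall.2 ((dist_pi_le_iff hε.le).2 fun i => ?_)
    have h1 := hcell i trivial
    rw [Real.dist_eq, abs_le]
    constructor <;> linarith [h1.1, h1.2]
  refine (coveringNumber_le_card S hcov).trans (le_trans ?_ hK)
  rw [hfin.encard_eq_coe_toFinset_card]
  exact_mod_cast Finset.card_image_le

theorem le_rpow_mul_entropyNumber (hd : 0 < d) {A : Set (Fin d → ℝ)} (hA : Bornology.IsBounded A)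
    {n : ℕ} (hn : 0 < n) :
    (1 / 2) * (volume A).toReal ^ (1 / (d : ℝ)) ≤ (n : ℝ) ^ (1 / (d : ℝ)) * entropyNumber n A := by
  have hn' : (0 : ℝ) < (n : ℝ) ^ (1 / (d : ℝ)) := by positivity
  rw [← div_le_iff₀' hn']
  refine le_csInf ?_ ?_
  · obtain ⟨R, hR, hAR⟩ := hA.subset_closedBall_lt 0 0
    refine ⟨R, hR, (coveringNumber_le_card {0} (by simpa using hAR)).trans ?_⟩
    rw [Finset.card_singleton]
    exact_mod_cast hn
  · rintro ε ⟨hε, h⟩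
    rw [div_le_iff₀' hn']
    have h1 : (volume A).toReal ≤ n * (2 * ε) ^ d :=
      ENNReal.toReal_le_of_le_ofReal (by positivity) (volume_le_of_coveringNumber_le hε.le h)
    have h2 : (volume A).toReal ^ (1 / (d : ℝ)) ≤ (n : ℝ) ^ (1 / (d : ℝ)) * (2 * ε) := by
      refine (Real.rpow_le_rpow ENNReal.toReal_nonneg h1 (by positivity)).trans_eq ?_
      rw [Real.mul_rpow (by positivity) (by positivity), one_div,
        Real.pow_rpow_inv_natCast (by positivity) hd.ne']
    linarith

theorem eventually_rpow_mul_entropyNumber_le (hd : 0 < d) {A : Set (Fin d → ℝ)}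
    (hA : IsCompact A) {c : ℝ} (hc : (1 / 2) * (volume A).toReal ^ (1 / (d : ℝ)) < c) :
    ∀ᶠ n : ℕ in atTop, (n : ℝ) ^ (1 / (d : ℝ)) * entropyNumber n A ≤ c := by
  have hc0 : 0 < c := lt_of_le_of_lt (by positivity) hc
  have hd' : (0 : ℝ) < d := by exact_mod_cast hd
  have hvol : volume A < ENNReal.ofReal ((2 * c) ^ d) := by
    rw [ENNReal.lt_ofReal_iff_toReal_lt hA.measure_lt_top.ne]
    have h := pow_lt_pow_left₀ (show (volume A).toReal ^ (1 / (d : ℝ)) < 2 * c by linarith)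
      (by positivity) hd.ne'
    rwa [one_div, Real.rpow_inv_natCast_pow ENNReal.toReal_nonneg hd.ne'] at h
  have hlim : Tendsto (fun n : ℕ => 2 * (c / (n : ℝ) ^ (1 / (d : ℝ)))) atTop (nhds 0) := by
    have := ((tendsto_rpow_atTop (show 0 < 1 / (d : ℝ) by positivity)).comp
      tendsto_natCast_atTop_atTop).const_div_atTop c |>.const_mul 2
    simpa using this
  have hev := ((tendsto_measure_cthickening_of_isCompact (μ := volume) hA).comp hlim).eventually
    (gt_mem_nhds hvol)
  filter_upwards [hev, eventually_gt_atTop 0] with n hn hn0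
  have hn' : (0 : ℝ) < (n : ℝ) ^ (1 / (d : ℝ)) := by positivity
  rw [← le_div_iff₀' hn']
  have hε : 0 < c / (n : ℝ) ^ (1 / (d : ℝ)) := by positivity
  refine csInf_le ⟨0, fun _ h => h.1.le⟩
    ⟨hε, coveringNumber_le_of_volume_cthickening_lt hε (lt_of_lt_of_le hn ?_)⟩
  refine ENNReal.ofReal_le_ofReal ?_
  have hpow : ((n : ℝ) ^ (1 / (d : ℝ))) ^ d = n := by
    rw [one_div, Real.rpow_inv_natCast_pow (by positivity) hd.ne']
  have hn1 : (0 : ℝ) < n := by exact_mod_cast hn0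
  rw [← mul_div_assoc, div_pow, hpow, mul_div_assoc', le_div_iff₀ hn1]
  nlinarith [pow_pos (show 0 < 2 * c by positivity) d]

/-- Asymptotics of the entropy numbers of a compact set with respect to the sup-norm. -/
theorem tendsto_rpow_mul_entropyNumber (hd : 0 < d) {A : Set (Fin d → ℝ)} (hA : IsCompact A) :
    Tendsto (fun n : ℕ => (n : ℝ) ^ (1 / (d : ℝ)) * entropyNumber n A) atTop
      (nhds ((1 / 2) * (volume A).toReal ^ (1 / (d : ℝ)))) := by
  refine tendsto_order.2 ⟨fun a ha => ?_, fun a ha => ?_⟩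
  · filter_upwards [eventually_gt_atTop 0] with n hn
    exact ha.trans_le (le_rpow_mul_entropyNumber hd hA.isBounded hn)
  · obtain ⟨c, hc, hca⟩ := exists_between ha
    filter_upwards [eventually_rpow_mul_entropyNumber_le hd hA hc] with n hn
    exact hn.trans_lt hca

theorem continuous_pNorm_rpow {p : ℝ} (hp0 : 0 < p) {nrm : (Fin d → ℝ) → ℝ}
    (hnn : ∀ x, 0 ≤ nrm x) (hhom : ∀ (c : ℝ) (x : Fin d → ℝ), nrm (c • x) = |c| * nrm x)
    (htri : ∀ x y, nrm (x + y) ^ p ≤ nrm x ^ p + nrm y ^ p) :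
    Continuous fun x => nrm x ^ p := by
  have h0 : nrm 0 ^ p = 0 := by
    have := hhom 0 0
    rw [smul_zero, abs_zero, zero_mul] at this
    rw [this, Real.zero_rpow hp0.ne']
  have hsum : ∀ x : Fin d → ℝ, nrm x ^ p ≤ ∑ i, |x i| ^ p * nrm (Pi.single i 1) ^ p := by
    intro x
    have hx : x = ∑ i, x i • (Pi.single i 1 : Fin d → ℝ) := by
      ext j
      simp [Finset.sum_apply, Pi.single_apply]
    conv_lhs => rw [hx]
    refine (Finset.le_sum_of_subadditive (fun x => nrm x ^ p) h0.le htri _ _).trans_eq ?_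
    refine Finset.sum_congr rfl fun i _ => ?_
    rw [hhom, Real.mul_rpow (abs_nonneg _) (hnn _)]
  have hneg : ∀ x, nrm (-x) = nrm x := fun x => by simpa using hhom (-1) x
  refine continuous_iff_continuousAt.2 fun x => ?_
  rw [ContinuousAt, tendsto_iff_dist_tendsto_zero]
  have hg : Tendsto (fun y => ∑ i, |(y - x) i| ^ p * nrm (Pi.single i 1) ^ p) (nhds x)
      (nhds 0) := by
    have hcont : Continuous fun y : Fin d → ℝ =>
        ∑ i, |(y - x) i| ^ p * nrm (Pi.single i 1) ^ p :=
      continuous_finsetSum _ fun i _ => Continuous.mul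
        (Continuous.rpow_const (by fun_prop) fun _ => Or.inr hp0.le) continuous_const
    simpa [Real.zero_rpow hp0.ne'] using hcont.tendsto x
  refine squeeze_zero (fun _ => dist_nonneg) (fun y => ?_) hg
  refine le_trans ?_ (hsum (y - x))
  have h1 := htri (y - x) x
  have h2 := htri (x - y) y
  rw [sub_add_cancel] at h1 h2
  rw [← neg_sub y x, hneg] at h2
  rw [Real.dist_eq, abs_le]
  constructor <;> linarith

theorem isCompact_pNorm_unitBall {p : ℝ} (hp0 : 0 < p)
    {nrm : (Fin d → ℝ) → ℝ} (hnn : ∀ x, 0 ≤ nrm x) (hzero : ∀ x, nrm x = 0 ↔ x = 0)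
    (hhom : ∀ (c : ℝ) (x : Fin d → ℝ), nrm (c • x) = |c| * nrm x)
    (htri : ∀ x y, nrm (x + y) ^ p ≤ nrm x ^ p + nrm y ^ p) :
    IsCompact {x | nrm x ≤ 1} := by
  have hcont : Continuous nrm := by
    have h := (continuous_pNorm_rpow hp0 hnn hhom htri).rpow_const (p := p⁻¹)
      fun _ => Or.inr (by positivity)
    simpa [Real.rpow_rpow_inv (hnn _) hp0.ne'] using h
  refine Metric.isCompact_of_isClosed_isBounded (isClosed_le hcont continuous_const) ?_
  obtain ⟨m, hm, hmin⟩ : ∃ m, 0 < m ∧ ∀ x ∈ Metric.sphere (0 : Fin d → ℝ) 1, m ≤ nrm x := by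
    refine (isCompact_sphere _ _).exists_forall_le' hcont.continuousOn fun x hx => ?_
    refine (hnn x).lt_of_ne' fun h => ?_
    rw [(hzero x).1 h] at hx
    simp at hx
  refine isBounded_iff_forall_norm_le.2 ⟨m⁻¹, fun x hx => ?_⟩
  rcases eq_or_ne x 0 with rfl | hx0
  · simpa using hm.le
  have hpos : 0 < ‖x‖ := norm_pos_iff.2 hx0
  have h := hmin (‖x‖⁻¹ • x) (by simp [norm_smul, hpos.ne'])
  rw [hhom, abs_of_pos (inv_pos.2 hpos), le_inv_mul_iff₀ hpos] at h
  rw [← one_div, le_div_iff₀ hm]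
  exact h.trans hx

end EntropyAsymptotics

/-- `lim_n n^{1/d} ε_n(id : ℓ_{‖·‖}^d → ℓ_∞^d) = (1/2) vol(B_{‖·‖}^d)^{1/d}`
for a `p`-norm `‖·‖` on `ℝ^d`, `0 < p ≤ 1`. -/
theorem statement7 (d : ℕ) (hd : 0 < d) (p : ℝ) (hp0 : 0 < p) (hp1 : p ≤ 1)
    (nrm : (Fin d → ℝ) → ℝ)
    (hnn : ∀ x, 0 ≤ nrm x)
    (hzero : ∀ x, nrm x = 0 ↔ x = 0)
    (hhom : ∀ (c : ℝ) (x : Fin d → ℝ), nrm (c • x) = |c| * nrm x)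
    (htri : ∀ x y, nrm (x + y) ^ p ≤ nrm x ^ p + nrm y ^ p) :
    Filter.Tendsto
      (fun n : ℕ => (n : ℝ) ^ (1 / (d : ℝ)) * entropyNumber n {x | nrm x ≤ 1})
      Filter.atTop
      (nhds ((1 / 2) * (volume {x | nrm x ≤ 1}).toReal ^ (1 / (d : ℝ)))) := by
  exact tendsto_rpow_mul_entropyNumber hd (isCompact_pNorm_unitBall hp0 hnn hzero hhom htri)

end
end

section
/- Let s > 0 and d ∈ ℕ. Then for all n ∈ ℕ: 2^{−s} n^{−s/d} ≤ a_n(Id: H^{s,∞}(T^d) → L2(T^d)) ≤ 8^s n^{−s/d}. Moreover, a_n(Id: H^{s,∞}(T^d) → L2(T^d)) = 1 for all n ≤ 2^d. -/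
open MeasureTheory Real Filter
open scoped ENNReal NNReal BigOperators

noncomputable section

instance (d : ℕ) : IsFiniteMeasure (torusMeasure d) := by
  refine ⟨?_⟩
  rw [torusMeasure, Measure.restrict_apply_univ, volume_pi, Measure.pi_pi]
  exact ENNReal.prod_lt_top fun _ _ => measure_Icc_lt_top

lemma torusMeasure_eq_pi (d : ℕ) :
    torusMeasure d = Measure.pi fun _ : Fin d => volume.restrict (Set.Icc 0 (2 * π)) := by
  rw [torusMeasure, volume_pi, Measure.restrict_pi_pi]

lemma norm_exp_neg_I_mul_ofReal (t : ℝ) : ‖Complex.exp (-Complex.I * (t : ℂ))‖ = 1 := by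
  rw [Complex.norm_exp]
  simp

lemma integrable_mul_exp {d : ℕ} (f : TorusL2 d) (k : Fin d → ℤ) :
    Integrable (fun x => f x *
      Complex.exp (-Complex.I * ((∑ j, (k j : ℝ) * x j : ℝ) : ℂ))) (torusMeasure d) := by
  refine ((Lp.memLp f).integrable (by norm_num)).mul_bdd (c := 1) ?_ ?_
  · exact Continuous.aestronglyMeasurable (by fun_prop)
  · exact Eventually.of_forall fun x => (norm_exp_neg_I_mul_ofReal _).le

/-- The Fourier coefficient as a linear functional on `L2(T^d)`. -/
def fourierCoeffLM {d : ℕ} (k : Fin d → ℤ) : TorusL2 d →ₗ[ℂ] ℂ where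
  toFun f := fourierCoeffT f k
  map_add' f g := by
    simp only [fourierCoeffT]
    rw [← mul_add, ← integral_add (integrable_mul_exp f k) (integrable_mul_exp g k)]
    congr 1
    refine integral_congr_ae ?_
    filter_upwards [Lp.coeFn_add f g] with x hx
    rw [hx, Pi.add_apply, add_mul]
  map_smul' c f := by
    simp only [fourierCoeffT, RingHom.id_apply, smul_eq_mul]
    rw [mul_left_comm, ← integral_const_mul c]
    congr 1
    refine integral_congr_ae ?_
    filter_upwards [Lp.coeFn_smul c f] with x hx
    rw [hx, Pi.smul_apply, smul_eq_mul, mul_assoc]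

lemma memLp_exp {d : ℕ} (k : Fin d → ℤ) :
    MemLp (fun x : Fin d → ℝ => (((2 * π) ^ (-(d : ℝ) / 2) : ℝ) : ℂ) *
      Complex.exp (Complex.I * ((∑ j, (k j : ℝ) * x j : ℝ) : ℂ))) 2 (torusMeasure d) := by
  refine MemLp.of_bound (Continuous.aestronglyMeasurable (by fun_prop))
    ‖(((2 * π) ^ (-(d : ℝ) / 2) : ℝ) : ℂ)‖ (Eventually.of_forall fun x => ?_)
  rw [norm_mul, Complex.norm_exp_I_mul_ofReal, mul_one]

/-- The normalized exponential `(2π)^{-d/2} e^{i k·x}`. -/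
def expL2 {d : ℕ} (k : Fin d → ℤ) : TorusL2 d := (memLp_exp k).toLp _

lemma integral_exp_I_int (m : ℤ) :
    ∫ x in Set.Icc 0 (2 * π), Complex.exp (Complex.I * ((m : ℝ) * x : ℝ)) =
      if m = 0 then ((2 * π : ℝ) : ℂ) else 0 := by
  rw [integral_Icc_eq_integral_Ioc, ← intervalIntegral.integral_of_le (by positivity)]
  split_ifs with h
  · simp [h]
  · have hm : Complex.I * (m : ℂ) ≠ 0 := by simp [h]
    have := integral_exp_mul_complex (a := 0) (b := 2 * π) hm
    push_cast at this ⊢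
    simp only [← mul_assoc] at this ⊢
    rw [this]
    have h1 : Complex.exp (Complex.I * m * 2 * π) = 1 := by
      rw [← Complex.exp_int_mul_two_pi_mul_I m]
      ring_nf
    simp [h1]

lemma fourierCoeffLM_expL2 {d : ℕ} (k l : Fin d → ℤ) :
    fourierCoeffLM k (expL2 l) = if l = k then 1 else 0 := by
  change fourierCoeffT (expL2 l) k = _
  set c : ℝ := (2 * π) ^ (-(d : ℝ) / 2) with hc
  have hcc : c * c * (2 * π) ^ d = 1 := by
    rw [hc, ← Real.rpow_add (by positivity), ← Real.rpow_natCast,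
      ← Real.rpow_add (by positivity)]
    ring_nf
    simp
  have key : ∫ x, (expL2 l : TorusL2 d) x *
      Complex.exp (-Complex.I * ((∑ j, (k j : ℝ) * x j : ℝ) : ℂ)) ∂(torusMeasure d) =
      c * ∏ j, if l j - k j = 0 then ((2 * π : ℝ) : ℂ) else 0 := by
    simp_rw [← integral_exp_I_int]
    rw [← integral_fintype_prod_eq_prod (𝕜 := ℂ) (fun j (y : ℝ) =>
      Complex.exp (Complex.I * (((l j - k j : ℤ) : ℝ) * y : ℝ))), ← integral_const_mul,
      ← torusMeasure_eq_pi]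
    refine integral_congr_ae ?_
    filter_upwards [(memLp_exp l).coeFn_toLp] with x hx
    rw [expL2, hx, mul_assoc, ← Complex.exp_add, ← Complex.exp_sum]
    congr 2
    push_cast
    rw [Finset.mul_sum, Finset.mul_sum, ← Finset.sum_add_distrib]
    exact Finset.sum_congr rfl fun j _ => by ring
  rw [fourierCoeffT, key, ← hc]
  clear_value c
  split_ifs with h
  · subst h
    simp only [sub_self, if_true, Finset.prod_const, Finset.card_univ, Fintype.card_fin]
    rw [← mul_assoc]
    exact_mod_cast hcc
  · obtain ⟨j, hj⟩ := Function.ne_iff.mp h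
    rw [Finset.prod_eq_zero (Finset.mem_univ j) (by rw [if_neg (sub_ne_zero.mpr hj)])]
    simp

lemma fourierCoeffLM_sum_smul_expL2 {d : ℕ} (K : Finset (Fin d → ℤ)) (c : (Fin d → ℤ) → ℂ)
    (k : Fin d → ℤ) :
    fourierCoeffLM k (∑ l ∈ K, c l • expL2 l) = if k ∈ K then c k else 0 := by
  simp [map_sum, fourierCoeffLM_expL2]

lemma fourierCoeffT_eq {d : ℕ} (f : TorusL2 d) (k : Fin d → ℤ) :
    fourierCoeffT f k = fourierCoeffLM k f := rfl

lemma approxNumber_le_s11 {d n : ℕ} {w : (Fin d → ℤ) → ℝ} {r : ℝ} (hr : 0 ≤ r)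
    (K : Finset (Fin d → ℤ)) (hK : K.card < n) (hw : ∀ k ∉ K, 1 ≤ r * w k) :
    approxNumber d w (constOne d) n ≤ r := by
  refine csInf_le ⟨0, fun x hx => hx.1⟩ ⟨hr, ∑ k ∈ K, (fourierCoeffLM k).smulRight (expL2 k), ?_⟩
  set A : TorusL2 d →ₗ[ℂ] TorusL2 d :=
    ∑ k ∈ K, (fourierCoeffLM k).smulRight (expL2 k) with hA
  have hAf (f) : A f = ∑ k ∈ K, fourierCoeffLM k f • expL2 k := by
    simp [hA]
  classical
  have hle : LinearMap.range A ≤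
      Submodule.span ℂ (K.image (expL2 (d := d)) : Set (TorusL2 d)) := by
    rintro _ ⟨f, rfl⟩
    rw [hAf]
    exact Submodule.sum_mem _ fun k hk => Submodule.smul_mem _ _
      (Submodule.subset_span (by simpa using ⟨k, hk, rfl⟩))
  refine ⟨Submodule.finiteDimensional_of_le hle, ?_, fun f hf => ?_⟩
  · exact (Submodule.finrank_mono hle).trans_lt
      ((finrank_span_finset_le_card _).trans_lt (Finset.card_image_le.trans_lt hK))
  · calc wNormSq (constOne d) (f - A f)
        ≤ ∑' k, ENNReal.ofReal r ^ 2 * ENNReal.ofReal (w k ^ 2 * ‖fourierCoeffT f k‖ ^ 2) := by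
          refine ENNReal.tsum_le_tsum fun k => ?_
          rw [← ENNReal.ofReal_pow hr, ← ENNReal.ofReal_mul (by positivity)]
          refine ENNReal.ofReal_le_ofReal ?_
          rw [fourierCoeffT_eq, map_sub, hAf, fourierCoeffLM_sum_smul_expL2, fourierCoeffT_eq]
          split_ifs with hk
          · simp only [sub_self, norm_zero, constOne]
            rw [zero_pow two_ne_zero, mul_zero]
            positivity
          · rw [sub_zero, ← mul_assoc, ← mul_pow r, constOne]
            exact mul_le_mul_of_nonneg_right
              (pow_le_pow_left₀ zero_le_one (hw k hk) 2) (by positivity)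
      _ = ENNReal.ofReal r ^ 2 * wNormSq w f := by rw [ENNReal.tsum_mul_left, wNormSq]
      _ ≤ ENNReal.ofReal r ^ 2 := mul_le_of_le_one_right' hf

lemma wNormSq_sum_smul_expL2 {d : ℕ} (w : (Fin d → ℤ) → ℝ) (K : Finset (Fin d → ℤ))
    (c : (Fin d → ℤ) → ℂ) :
    wNormSq w (∑ l ∈ K, c l • expL2 l) = ENNReal.ofReal (∑ k ∈ K, w k ^ 2 * ‖c k‖ ^ 2) := by
  rw [wNormSq, tsum_eq_sum (s := K), ENNReal.ofReal_sum_of_nonneg fun k _ => by positivity]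
  · refine Finset.sum_congr rfl fun k hk => ?_
    rw [fourierCoeffT_eq, fourierCoeffLM_sum_smul_expL2, if_pos hk]
  · intro k hk
    rw [fourierCoeffT_eq, fourierCoeffLM_sum_smul_expL2, if_neg hk]
    simp

lemma exists_sum_smul_mem_ker {V ι : Type*} [AddCommGroup V] [Module ℂ V] (A : V →ₗ[ℂ] V)
    [Module.Finite ℂ (LinearMap.range A)] (K : Finset ι)
    (hK : Module.finrank ℂ (LinearMap.range A) < K.card) (e : ι → V) :
    ∃ c : ι → ℂ, A (∑ k ∈ K, c k • e k) = 0 ∧ ∃ k ∈ K, c k ≠ 0 := by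
  classical
  let L : (K → ℂ) →ₗ[ℂ] LinearMap.range A :=
    A.rangeRestrict ∘ₗ Fintype.linearCombination ℂ fun k : K => e k
  have hker : LinearMap.ker L ≠ ⊥ := LinearMap.ker_ne_bot_of_finrank_lt (by simpa using hK)
  obtain ⟨c, hc, hc0⟩ := (Submodule.ne_bot_iff _).mp hker
  obtain ⟨k, hk⟩ := Function.ne_iff.mp hc0
  refine ⟨fun i => if h : i ∈ K then c ⟨i, h⟩ else 0, ?_, k, k.2, by simpa using hk⟩
  have h0 := congrArg Subtype.val (LinearMap.mem_ker.mp hc)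
  rw [← Finset.sum_attach]
  simpa [L, Fintype.linearCombination_apply, -map_sum] using h0

lemma le_approxNumber_s11 {d n : ℕ} {w : (Fin d → ℤ) → ℝ} {r : ℝ} (hr : 0 < r) (hn : 0 < n)
    (hw1 : ∀ k, 1 ≤ w k) (K : Finset (Fin d → ℤ)) (hK : n ≤ K.card)
    (hw : ∀ k ∈ K, r * w k ≤ 1) :
    r ≤ approxNumber d w (constOne d) n := by
  refine le_csInf ⟨1, zero_le_one, 0, ?_, ?_, fun f hf => ?_⟩ ?_
  · rw [LinearMap.range_zero]; infer_instance
  · rw [LinearMap.range_zero, finrank_bot]; exact hn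
  · simp only [LinearMap.zero_apply, sub_zero, ENNReal.ofReal_one, one_pow]
    refine le_trans (ENNReal.tsum_le_tsum fun k => ENNReal.ofReal_le_ofReal ?_) hf
    exact mul_le_mul_of_nonneg_right
      (pow_le_pow_left₀ zero_le_one (hw1 k) 2) (by positivity)
  · rintro ρ ⟨hρ, A, hfin, hrank, hA⟩
    obtain ⟨c, hAc, k₀, hk₀, hck₀⟩ :=
      exists_sum_smul_mem_ker A K (hrank.trans_le hK) expL2
    set S : ℝ := ∑ k ∈ K, w k ^ 2 * ‖c k‖ ^ 2 with hS
    have hSpos : 0 < S := by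
      refine Finset.sum_pos' (fun k _ => by positivity) ⟨k₀, hk₀, ?_⟩
      have := zero_lt_one.trans_le (hw1 k₀)
      positivity
    set t : ℂ := (((√S)⁻¹ : ℝ) : ℂ) with ht
    have htn : ‖t‖ ^ 2 = S⁻¹ := by
      rw [ht, Complex.norm_real, Real.norm_eq_abs, sq_abs, inv_pow, Real.sq_sqrt hSpos.le]
    have hfsum : t • ∑ k ∈ K, c k • expL2 k = ∑ k ∈ K, (t * c k) • expL2 (d := d) k := by
      simp only [Finset.smul_sum, smul_smul]
    have hsum (v : (Fin d → ℤ) → ℝ) : ∑ k ∈ K, v k ^ 2 * ‖t * c k‖ ^ 2 =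
        S⁻¹ * ∑ k ∈ K, v k ^ 2 * ‖c k‖ ^ 2 := by
      rw [Finset.mul_sum]
      refine Finset.sum_congr rfl fun k _ => ?_
      rw [norm_mul, mul_pow, htn]
      ring
    have h := hA (∑ k ∈ K, (t * c k) • expL2 k) (by
      rw [wNormSq_sum_smul_expL2 w K fun k => t * c k, hsum, ← hS, inv_mul_cancel₀ hSpos.ne',
        ENNReal.ofReal_one])
    rw [← hfsum, map_smul, hAc, smul_zero, sub_zero, hfsum,
      wNormSq_sum_smul_expL2 _ K fun k => t * c k, hsum, ← ENNReal.ofReal_pow hρ,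
      ENNReal.ofReal_le_ofReal_iff (by positivity)] at h
    have h2 : r ^ 2 * S ≤ ∑ k ∈ K, constOne d k ^ 2 * ‖c k‖ ^ 2 := by
      rw [hS, Finset.mul_sum]
      refine Finset.sum_le_sum fun k hk => ?_
      rw [← mul_assoc, ← mul_pow, constOne]
      exact mul_le_mul_of_nonneg_right (pow_le_pow_left₀
        (mul_nonneg hr.le (zero_le_one.trans (hw1 k))) (hw k hk) 2) (by positivity)
    have h3 : r ^ 2 ≤ ρ ^ 2 := by
      refine le_trans ?_ h
      rw [inv_mul_eq_div, le_div_iff₀ hSpos]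
      exact h2
    exact (sq_le_sq₀ hr.le hρ).mp h3

/-- The integer points of the cube `[-m, m]^d`. -/
def intCube (d m : ℕ) : Finset (Fin d → ℤ) :=
  Fintype.piFinset fun _ => Finset.Icc (-(m : ℤ)) m

lemma card_intCube (d m : ℕ) : (intCube d m).card = (2 * m + 1) ^ d := by
  rw [intCube, Fintype.card_piFinset_const, Int.card_Icc]
  congr 1
  omega

lemma mem_intCube {d m : ℕ} {k : Fin d → ℤ} : k ∈ intCube d m ↔ ∀ j, |k j| ≤ m := by
  simp [intCube, abs_le]

lemma one_le_wIso_top {d : ℕ} {s : ℝ} (hs : 0 < s) (k : Fin d → ℤ) : 1 ≤ wIso d s ∞ k := by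
  rw [wIso, if_pos rfl]
  exact Real.one_le_rpow (le_max_left _ _) hs.le

lemma wIso_top_le {d m : ℕ} {s : ℝ} (hs : 0 < s) {k : Fin d → ℤ} (hk : k ∈ intCube d (m + 1)) :
    wIso d s ∞ k ≤ ((m + 1 : ℕ) : ℝ) ^ s := by
  rw [wIso, if_pos rfl]
  refine Real.rpow_le_rpow (by positivity) (max_le (by simp) ?_) hs.le
  refine Real.iSup_le (fun j => ?_) (by positivity)
  exact_mod_cast mem_intCube.mp hk j

lemma le_wIso_top {d m : ℕ} {s : ℝ} (hs : 0 < s) {k : Fin d → ℤ} (hk : k ∉ intCube d m) :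
    ((m + 1 : ℕ) : ℝ) ^ s ≤ wIso d s ∞ k := by
  rw [wIso, if_pos rfl]
  refine Real.rpow_le_rpow (by positivity) (le_max_of_le_right ?_) hs.le
  rw [mem_intCube] at hk
  push Not at hk
  obtain ⟨j, hj⟩ := hk
  refine le_trans ?_ (le_ciSup (Finite.bddAbove_range fun j => |(k j : ℝ)|) j)
  exact_mod_cast hj

lemma approxNumber_wIso_top {d n m : ℕ} {s : ℝ} (hs : 0 < s) (hn : 0 < n)
    (hlt : m = 0 ∨ (2 * m + 1) ^ d < n) (hle : n ≤ (2 * (m + 1) + 1) ^ d) :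
    approxNumber d (wIso d s ∞) (constOne d) n = ((m + 1 : ℕ) : ℝ) ^ (-s) := by
  have hinv : ((m + 1 : ℕ) : ℝ) ^ (-s) * ((m + 1 : ℕ) : ℝ) ^ s = 1 := by
    rw [← Real.rpow_add (by positivity)]
    simp
  refine le_antisymm ?_ (le_approxNumber_s11 (by positivity) hn (one_le_wIso_top hs)
    (intCube d (m + 1)) (by rwa [card_intCube]) fun k hk => ?_)
  · rcases hlt with rfl | hlt
    · exact approxNumber_le_s11 (by positivity) ∅ (by simpa using hn) fun k _ => by
        simpa using one_le_wIso_top hs k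
    · refine approxNumber_le_s11 (by positivity) (intCube d m) (by rwa [card_intCube]) fun k hk => ?_
      rw [← hinv]
      exact mul_le_mul_of_nonneg_left (le_wIso_top hs hk) (by positivity)
  · rw [← hinv]
    exact mul_le_mul_of_nonneg_left (wIso_top_le hs hk) (by positivity)

lemma exists_cube_level {d n : ℕ} (hd : 0 < d) :
    ∃ m : ℕ, (m = 0 ∨ (2 * m + 1) ^ d < n) ∧ n ≤ (2 * (m + 1) + 1) ^ d := by
  classical
  have hex : ∃ m : ℕ, n ≤ (2 * (m + 1) + 1) ^ d :=
    ⟨n, le_trans (by omega) (Nat.le_self_pow hd.ne' _)⟩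
  refine ⟨Nat.find hex, ?_, Nat.find_spec hex⟩
  rcases h : Nat.find hex with _ | p
  · exact Or.inl rfl
  · exact Or.inr (not_le.mp (Nat.find_min hex (h ▸ p.lt_succ_self)))

/-- `2^{-s} n^{-s/d} ≤ a_n(Id : H^{s,∞}(T^d) → L2(T^d)) ≤ 8^s n^{-s/d}`
for all `n`, and `a_n = 1` for `n ≤ 2^d`. -/
theorem statement11 (s : ℝ) (hs : 0 < s) (d : ℕ) (hd : 0 < d) :
    (∀ n : ℕ, 0 < n →
      (2 : ℝ) ^ (-s) * (n : ℝ) ^ (-(s / (d : ℝ)))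
          ≤ approxNumber d (wIso d s ∞) (constOne d) n ∧
      approxNumber d (wIso d s ∞) (constOne d) n
          ≤ (8 : ℝ) ^ s * (n : ℝ) ^ (-(s / (d : ℝ)))) ∧
    (∀ n : ℕ, 0 < n → n ≤ 2 ^ d → approxNumber d (wIso d s ∞) (constOne d) n = 1) := by
  refine ⟨fun n hn => ?_, fun n hn hn2 => ?_⟩
  · obtain ⟨m, hlt, hle⟩ := exists_cube_level (n := n) hd
    rw [approxNumber_wIso_top hs hn hlt hle]
    have hdR : (0 : ℝ) < d := by exact_mod_cast hd
    have hnR : (1 : ℝ) ≤ n := by exact_mod_cast hn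
    set t : ℝ := (n : ℝ) ^ ((d : ℝ)⁻¹) with ht
    have ht0 : 0 < t := by positivity
    have htd : t ^ d = n := Real.rpow_inv_natCast_pow (by positivity) hd.ne'
    have hts : (n : ℝ) ^ (-(s / (d : ℝ))) = t ^ (-s) := by
      rw [ht, ← Real.rpow_mul (by positivity)]
      congr 1
      ring
    have hm : (m : ℝ) + 1 ≤ 2 * t := by
      rcases hlt with rfl | hlt
      · have : 1 ≤ t := Real.one_le_rpow hnR (by positivity)
        norm_num
        linarith
      · have : (2 * m + 1 : ℝ) ^ d < t ^ d := by
          rw [htd]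
          exact_mod_cast hlt
        have := lt_of_pow_lt_pow_left₀ d ht0.le this
        have : (0 : ℝ) ≤ m := by positivity
        linarith
    have hm' : t ≤ 8 * ((m : ℝ) + 1) := by
      have : t ^ d ≤ (2 * (m + 1) + 1 : ℝ) ^ d := by
        rw [htd]
        exact_mod_cast hle
      have := le_of_pow_le_pow_left₀ hd.ne' (by positivity) this
      have : (0 : ℝ) ≤ m := by positivity
      linarith
    rw [hts, ← Real.mul_rpow (by norm_num) ht0.le]
    push_cast
    refine ⟨Real.rpow_le_rpow_of_nonpos (by positivity) hm (by linarith), ?_⟩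
    have h8 : (8 : ℝ) ^ s = (8⁻¹ : ℝ) ^ (-s) := by
      rw [Real.rpow_neg (by norm_num), Real.inv_rpow (by norm_num), inv_inv]
    rw [h8, ← Real.mul_rpow (by norm_num) ht0.le]
    exact Real.rpow_le_rpow_of_nonpos (by positivity) (by linarith) (by linarith)
  · rw [approxNumber_wIso_top (m := 0) hs hn (Or.inl rfl)
      (hn2.trans (Nat.pow_le_pow_left (by norm_num) d))]
    simp

end
end

section
/- Let d ∈ ℕ and 1 ≤ r ≤ 2^d. Then G(ln(r)·B_1^d) ≤ G(ℋ_r^d) ≤ r · G(c·ln(r)·B_1^d), where c = 1 + 1/ln(2), B_1^d = {x ∈ R^d : Σ_{j=1}^d |x_j| ≤ 1}, ℋ_r^d = {x ∈ R^d : Π_{j=1}^d (1 + |x_j|) ≤ r} is the hyperbolic cross, and ln is the natural logarithm. -/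
open MeasureTheory Real Filter
open scoped ENNReal NNReal BigOperators

noncomputable section

theorem gridNumber_eq_encard {d : ℕ} (A : Set (Fin d → ℝ)) :
    gridNumber A = {k : Fin d → ℤ | (fun j => (k j : ℝ)) ∈ A}.encard := by
  have hinj : Function.Injective (fun (k : Fin d → ℤ) (j : Fin d) => (k j : ℝ)) := by
    intro a b h
    ext j
    exact Int.cast_injective (congrFun h j)
  rw [gridNumber, ← hinj.encard_image]
  congr 1
  ext x
  constructor
  · rintro ⟨hx, hm⟩
    choose m hm using hm
    obtain rfl : x = fun j => (m j : ℝ) := funext hm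
    exact ⟨m, hx, rfl⟩
  · rintro ⟨k, hk, rfl⟩
    exact ⟨hk, fun i => ⟨k i, rfl⟩⟩

/-- The integers of the same sign as `n` whose absolute value lies in
`[2 ^ |n| - 1, 2 ^ (|n| + 1) - 1)`. -/
def dyadicBlock (n : ℤ) : Finset ℤ :=
  if 0 ≤ n then Finset.Ico (2 ^ n.natAbs - 1) (2 ^ (n.natAbs + 1) - 1)
  else Finset.Ioc (1 - 2 ^ (n.natAbs + 1)) (1 - 2 ^ n.natAbs)

theorem card_dyadicBlock (n : ℤ) : (dyadicBlock n).card = 2 ^ n.natAbs := by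
  have h : ((2 : ℤ) ^ n.natAbs).toNat = 2 ^ n.natAbs := by
    rw [← Int.toNat_natCast (2 ^ n.natAbs)]
    push_cast
    rfl
  unfold dyadicBlock
  split_ifs
  · rw [Int.card_Ico, ← h]
    congr 1
    ring
  · rw [Int.card_Ioc, ← h]
    congr 1
    ring

theorem exists_mem_dyadicBlock (k : ℤ) :
    ∃ n : ℤ, k ∈ dyadicBlock n ∧ 2 ^ n.natAbs ≤ k.natAbs + 1 := by
  have h1 : 2 ^ Nat.log 2 (k.natAbs + 1) ≤ k.natAbs + 1 := Nat.pow_log_le_self 2 (by omega)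
  have h2 : k.natAbs + 1 < 2 ^ (Nat.log 2 (k.natAbs + 1) + 1) :=
    Nat.lt_pow_succ_log_self (by norm_num) _
  set l := Nat.log 2 (k.natAbs + 1) with hl
  have h1' : (2 : ℤ) ^ l ≤ k.natAbs + 1 := by exact_mod_cast h1
  have h2' : (k.natAbs : ℤ) + 1 < 2 ^ (l + 1) := by exact_mod_cast h2
  rcases le_or_gt 0 k with hk | hk
  · refine ⟨l, ?_, by simpa using h1⟩
    rw [dyadicBlock, if_pos (by omega), Finset.mem_Ico, Int.natAbs_natCast]
    constructor <;> omega
  · have hpos : 0 < l := Nat.log_pos (by norm_num) (by omega)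
    refine ⟨-l, ?_, by simpa using h1⟩
    rw [dyadicBlock, if_neg (by omega), Finset.mem_Ioc, Int.natAbs_neg, Int.natAbs_natCast]
    constructor <;> omega

theorem encard_hyperbolicCross_le {d : ℕ} {r : ℝ} (hr : 0 ≤ r) :
    (({k : Fin d → ℤ | ∏ j, (1 + |(k j : ℝ)|) ≤ r}.encard : ℕ∞) : ℝ≥0∞) ≤
      ENNReal.ofReal r *
        (({m : Fin d → ℤ | (2 : ℝ) ^ ∑ j, (m j).natAbs ≤ r}.encard : ℕ∞) : ℝ≥0∞) := by
  set T := {m : Fin d → ℤ | (2 : ℝ) ^ ∑ j, (m j).natAbs ≤ r} with hT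
  have hfin : T.Finite := by
    obtain ⟨N, hN⟩ := pow_unbounded_of_one_lt r (one_lt_two : (1 : ℝ) < 2)
    refine (Set.finite_Icc (fun _ : Fin d => -(N : ℤ)) (fun _ => (N : ℤ))).subset ?_
    intro m hm
    have hs : ∑ j, (m j).natAbs < N :=
      (pow_lt_pow_iff_right₀ (one_lt_two : (1 : ℝ) < 2)).1 (lt_of_le_of_lt hm hN)
    have hb : ∀ j, (m j).natAbs ≤ N := fun j =>
      (Finset.single_le_sum (fun i _ => Nat.zero_le (m i).natAbs) (Finset.mem_univ j)).trans hs.le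
    exact ⟨fun j => by have := hb j; dsimp only; omega, fun j => by have := hb j; dsimp only; omega⟩
  have hsub : {k : Fin d → ℤ | ∏ j, (1 + |(k j : ℝ)|) ≤ r} ⊆
      (hfin.toFinset.biUnion fun m => Fintype.piFinset fun j => dyadicBlock (m j) :
        Finset (Fin d → ℤ)) := by
    intro k hk
    choose m hm hle using fun j => exists_mem_dyadicBlock (k j)
    simp only [Finset.coe_biUnion, Set.mem_iUnion, Finset.mem_coe, Set.Finite.mem_toFinset,
      Fintype.mem_piFinset]
    refine ⟨m, ?_, hm⟩
    refine le_trans (b := ∏ j, (1 + |(k j : ℝ)|)) ?_ hk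
    rw [← Finset.prod_pow_eq_pow_sum]
    refine Finset.prod_le_prod (fun _ _ => by positivity) fun j _ => ?_
    have h : (2 : ℝ) ^ (m j).natAbs ≤ (k j).natAbs + 1 := by exact_mod_cast hle j
    rwa [Nat.cast_natAbs, Int.cast_abs, add_comm] at h
  have hcard : (hfin.toFinset.biUnion fun m => Fintype.piFinset fun j => dyadicBlock (m j)).card ≤
      hfin.toFinset.card * ⌊r⌋₊ := by
    refine Finset.card_biUnion_le_card_mul _ _ _ fun m hm => ?_
    rw [Fintype.card_piFinset]
    simp only [card_dyadicBlock, Finset.prod_pow_eq_pow_sum]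
    refine Nat.le_floor ?_
    push_cast
    exact hfin.mem_toFinset.1 hm
  have hle := (Set.encard_le_encard hsub).trans_eq (Set.encard_coe_eq_coe_finsetCard _)
  rw [hfin.encard_eq_coe_toFinset_card]
  calc _ ≤ (((hfin.toFinset.card * ⌊r⌋₊ : ℕ) : ℕ∞) : ℝ≥0∞) :=
        ENat.toENNReal_le.2 (hle.trans (by exact_mod_cast hcard))
    _ = (⌊r⌋₊ : ℝ≥0∞) * (hfin.toFinset.card : ℝ≥0∞) := by
        rw [ENat.toENNReal_coe, Nat.cast_mul, mul_comm]
    _ ≤ _ := by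
        rw [ENat.toENNReal_coe]
        gcongr
        rw [← ENNReal.ofReal_natCast]
        exact ENNReal.ofReal_le_ofReal (Nat.floor_le hr)

/-- for `1 ≤ r ≤ 2^d`,
`G(ln(r)·B_1^d) ≤ G(ℋ_r^d) ≤ r · G(c·ln(r)·B_1^d)` with `c = 1 + 1/ln 2`. -/
theorem statement15 (d : ℕ) (hd : 0 < d) (r : ℝ) (hr1 : 1 ≤ r) (hr2 : r ≤ 2 ^ d) :
    gridNumber {x : Fin d → ℝ | ∑ j, |x j| ≤ Real.log r}
        ≤ gridNumber {x : Fin d → ℝ | ∏ j, (1 + |x j|) ≤ r} ∧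
    ((gridNumber {x : Fin d → ℝ | ∏ j, (1 + |x j|) ≤ r} : ℕ∞) : ℝ≥0∞)
        ≤ ENNReal.ofReal r *
          ((gridNumber {x : Fin d → ℝ |
              ∑ j, |x j| ≤ (1 + 1 / Real.log 2) * Real.log r} : ℕ∞) : ℝ≥0∞) := by
  have hr0 : 0 < r := by linarith
  constructor
  · refine Set.encard_le_encard (Set.inter_subset_inter_left _ fun x hx => ?_)
    calc ∏ j, (1 + |x j|) ≤ ∏ j, Real.exp |x j| :=
          Finset.prod_le_prod (fun _ _ => by positivity) fun j _ => by
            linarith [Real.add_one_le_exp |x j|]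
      _ = Real.exp (∑ j, |x j|) := (Real.exp_sum _ _).symm
      _ ≤ r := (Real.le_log_iff_exp_le hr0).1 hx
  · rw [gridNumber_eq_encard, gridNumber_eq_encard]
    refine (encard_hyperbolicCross_le hr0.le).trans ?_
    refine mul_le_mul_right (ENat.toENNReal_le.2 (Set.encard_le_encard fun m hm => ?_)) _
    have hlog2 : 0 < Real.log 2 := Real.log_pos one_lt_two
    have h := Real.log_le_log (by positivity) (show (2 : ℝ) ^ ∑ j, (m j).natAbs ≤ r from hm)
    rw [Real.log_pow, ← le_div_iff₀ hlog2] at h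
    have hsum : ∑ j, |(m j : ℝ)| = ((∑ j, (m j).natAbs : ℕ) : ℝ) := by
      push_cast
      simp only [Nat.cast_natAbs, Int.cast_abs]
    calc ∑ j, |(m j : ℝ)| ≤ Real.log r / Real.log 2 := hsum ▸ h
      _ ≤ (1 + 1 / Real.log 2) * Real.log r := by
        rw [add_mul, one_mul, one_div_mul_eq_div]
        linarith [Real.log_nonneg hr1]

end
end
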